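/- arXiv:2309.00574 — 2 statements merged into one kernel-verified Lean document; each statement's English description precedes it below -/
import Mathlib

section
/- Suppose n > m(1 − 1/k), p > 0 and p > 1 − m/n, and that conditions (1.4) and (1.5) hold together with ∫_0^1 f(r) r^{−1−γ} dr = ∞, where γ = (n p + m/k)/(n − (1 − 1/k) m). Suppose furthermore that, instead of requiring u_{k−1} ≥ 0 a.e., one only requires that there exists ρ > 0 such that the function U(r) = ∫_{B_r} u_{k−1}(x) dx is nonnegative and nondecreasing on [ρ, ∞). Then every global weak solution u of the problem ∂_t^k u − Σ_{|α|=m} ∂^α a_α(x,t,u) ≥ f(|u|) in ℝ^{n+1}_+ with initial data ∂_t^i u(·,0) = u_i (0 ≤ i ≤ k−1) is trivial, i.e. u = 0 almost everywhere in ℝ^{n+1}_+. -/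
open MeasureTheory Real Set Filter

noncomputable section

/-- The spatial domain `ℝⁿ`. -/
abbrev Spc (n : ℕ) := EuclideanSpace ℝ (Fin n)

/-- The open ball `B_r` in `ℝⁿ` of radius `r` centered at `0`. -/
def ball0 (n : ℕ) (r : ℝ) : Set (Spc n) := Metric.ball 0 r

/-- The cylinder `Q_r^κ = B_r × (0, r^κ)`. -/
def cyl (n : ℕ) (r κ : ℝ) : Set (Spc n × ℝ) := ball0 n r ×ˢ Ioo 0 (r ^ κ)

/-- The half-space `ℝ^{n+1}_+ = ℝⁿ × (0, ∞)`. -/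
def halfSp (n : ℕ) : Set (Spc n × ℝ) := {z | 0 < z.2}

/-- The (finite) set of multi-indices `α` with `|α| = m`. -/
def mIdx (n m : ℕ) : Finset (Fin n → ℕ) :=
  (Fintype.piFinset fun _ : Fin n => Finset.range (m + 1)).filter fun α => ∑ i, α i = m

/-- Spatial partial derivative `∂/∂x_i`. -/
def spDeriv (n : ℕ) (i : Fin n) (φ : Spc n × ℝ → ℝ) : Spc n × ℝ → ℝ :=
  fun z => deriv (fun s : ℝ => φ (z.1 + s • EuclideanSpace.single i (1 : ℝ), z.2)) 0

/-- Time derivative `∂/∂t`. -/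
def tDeriv (n : ℕ) (φ : Spc n × ℝ → ℝ) : Spc n × ℝ → ℝ :=
  fun z => deriv (fun s : ℝ => φ (z.1, s)) z.2

/-- Multi-index spatial derivative `∂^α`. -/
def mDeriv (n : ℕ) (α : Fin n → ℕ) (φ : Spc n × ℝ → ℝ) : Spc n × ℝ → ℝ :=
  (List.finRange n).foldr (fun i ψ => (spDeriv n i)^[α i] ψ) φ

/-- Caratheodory conditions and the growth bound `|a_α(x,t,ζ)| ≤ A |ζ|^p` for the
coefficients of the operator `L`. -/
def GoodCoeffs (n m : ℕ) (A p : ℝ) (a : (Fin n → ℕ) → Spc n × ℝ → ℝ → ℝ) : Prop :=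
  ∀ α ∈ mIdx n m,
    (∀ ζ : ℝ, Measurable fun z => a α z ζ) ∧
    (∀ᵐ z ∂(volume.restrict (halfSp n)), Continuous fun ζ => a α z ζ) ∧
    (∀ᵐ z ∂(volume.restrict (halfSp n)), ∀ ζ : ℝ, |a α z ζ| ≤ A * |ζ| ^ p)

/-- The standing conditions on `f`: `ζ ↦ f ζ` and `ζ ↦ f (ζ^{1/p})` are nondecreasing
and convex on `[0,∞)`, and `f` is positive on `(0,∞)`. -/
def GoodF (p : ℝ) (f : ℝ → ℝ) : Prop :=
  MonotoneOn f (Ici 0) ∧ ConvexOn ℝ (Ici 0) f ∧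
  MonotoneOn (fun ζ => f (ζ ^ (1 / p))) (Ici 0) ∧
  ConvexOn ℝ (Ici 0) (fun ζ => f (ζ ^ (1 / p))) ∧
  ∀ ζ : ℝ, 0 < ζ → 0 < f ζ

/-- Condition (1.4): `∫_1^∞ ζ^{1/k - 1} f(ζ)^{-1/k} dζ < ∞`. -/
def Cond14 (k : ℕ) (f : ℝ → ℝ) : Prop :=
  IntegrableOn (fun ζ : ℝ => ζ ^ ((k : ℝ)⁻¹ - 1) / f ζ ^ ((k : ℝ)⁻¹)) (Ioi 1)

/-- Condition (1.5): `∫_1^∞ ζ^{p/m - 1} f(ζ)^{-1/m} dζ < ∞`. -/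
def Cond15 (m : ℕ) (p : ℝ) (f : ℝ → ℝ) : Prop :=
  IntegrableOn (fun ζ : ℝ => ζ ^ (p / (m : ℝ) - 1) / f ζ ^ ((m : ℝ)⁻¹)) (Ioi 1)

/-- `v ∈ L^1_loc(ℝⁿ)`. -/
def L1locInit (n : ℕ) (v : Spc n → ℝ) : Prop :=
  ∀ r : ℝ, 0 < r → IntegrableOn v (ball0 n r)

/-- `u` is a global weak solution of
`∂_t^k u - Σ_{|α| = m} ∂^α a_α(x,t,u) ≥ f(|u|)` in `ℝ^{n+1}_+`, with initial data
`∂_t^i u(·,0) = u0 i` for `0 ≤ i ≤ k-1`. -/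
def IsGlobalWeakSol (n k m : ℕ) (p : ℝ) (a : (Fin n → ℕ) → Spc n × ℝ → ℝ → ℝ)
    (f : ℝ → ℝ) (u0 : ℕ → Spc n → ℝ) (u : Spc n × ℝ → ℝ) : Prop :=
  (∀ r : ℝ, 0 < r → IntegrableOn u (cyl n r 1)) ∧
  (∀ r : ℝ, 0 < r → IntegrableOn (fun z => |u z| ^ p) (cyl n r 1)) ∧
  (∀ r : ℝ, 0 < r → IntegrableOn (fun z => f |u z|) (cyl n r 1)) ∧
  ∀ φ : Spc n × ℝ → ℝ, ContDiff ℝ (⊤ : ℕ∞) φ → HasCompactSupport φ →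
    (∀ z, 0 ≤ φ z) →
    (∫ z in halfSp n, (-1 : ℝ) ^ k * u z * (tDeriv n)^[k] φ z)
      - (∫ z in halfSp n, ∑ α ∈ mIdx n m, (-1 : ℝ) ^ m * a α z (u z) * mDeriv n α φ z)
    ≥ (∫ x : Spc n, ∑ i ∈ Finset.range k,
          (-1 : ℝ) ^ i * u0 (k - 1 - i) x * (tDeriv n)^[i] φ (x, 0))
      + ∫ z in halfSp n, f |u z| * φ z

/-- `u = 0` almost everywhere in `ℝ^{n+1}_+`. -/
def TrivialSol (n : ℕ) (u : Spc n × ℝ → ℝ) : Prop :=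
  ∀ᵐ z ∂(volume.restrict (halfSp n)), u z = 0

section Cutoff

/-- A smooth nonincreasing profile, equal to `1` on `(-∞, 1/3]` and to `0` on `[2/3, ∞)`. -/
def stepDown (y : ℝ) : ℝ := Real.smoothTransition (2 - 3 * y)

lemma stepDown_contDiff : ContDiff ℝ (⊤ : ℕ∞) stepDown :=
  Real.smoothTransition.contDiff.comp (by fun_prop)

lemma stepDown_antitone : Antitone stepDown := fun x y h =>
  Real.smoothTransition.monotone (by linarith)

lemma stepDown_nonneg (y : ℝ) : 0 ≤ stepDown y := Real.smoothTransition.nonneg _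

lemma stepDown_le_one (y : ℝ) : stepDown y ≤ 1 := Real.smoothTransition.le_one _

lemma stepDown_eq_one {y : ℝ} (h : y ≤ 1 / 3) : stepDown y = 1 :=
  Real.smoothTransition.one_of_one_le (by linarith)

lemma stepDown_eq_zero {y : ℝ} (h : 2 / 3 ≤ y) : stepDown y = 0 :=
  Real.smoothTransition.zero_of_nonpos (by linarith)

lemma exists_bound_iteratedFDeriv_stepDown (m : ℕ) :
    ∃ C : ℝ, 0 ≤ C ∧ ∀ i ≤ m, ∀ y ∈ Icc (0 : ℝ) 1, ‖iteratedFDeriv ℝ i stepDown y‖ ≤ C := by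
  have h : ∀ i : ℕ, ∃ C : ℝ, ∀ y ∈ Icc (0 : ℝ) 1, ‖iteratedFDeriv ℝ i stepDown y‖ ≤ C := fun i =>
    isCompact_Icc.exists_bound_of_continuousOn
      (stepDown_contDiff.continuous_iteratedFDeriv (by exact_mod_cast le_top)).continuousOn
  choose C hC using h
  refine ⟨∑ i ∈ Finset.range (m + 1), |C i|, Finset.sum_nonneg fun _ _ => abs_nonneg _,
    fun i hi y hy => (hC i y hy).trans ((le_abs_self _).trans ?_)⟩
  exact Finset.single_le_sum (f := fun i => |C i|) (fun _ _ => abs_nonneg _)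
    (Finset.mem_range.2 (by omega))

variable {V : Type*} [NormedAddCommGroup V]

/-- The radial cutoff: `1` on the ball of radius `r`, `0` outside the ball of radius `R`. -/
def radialCut (V : Type*) [NormedAddCommGroup V] (r R : ℝ) (x : V) : ℝ :=
  stepDown ((‖x‖ ^ 2 - r ^ 2) / (R ^ 2 - r ^ 2))

lemma radialCut_nonneg (r R : ℝ) (x : V) : 0 ≤ radialCut V r R x := stepDown_nonneg _

lemma radialCut_le_one (r R : ℝ) (x : V) : radialCut V r R x ≤ 1 := stepDown_le_one _

lemma radialCut_eventuallyEq_one {r R : ℝ} (hr : 0 < r) (hrR : r < R) {x : V} (hx : ‖x‖ ≤ r) :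
    radialCut V r R =ᶠ[nhds x] fun _ => 1 := by
  have hden : 0 < R ^ 2 - r ^ 2 := by nlinarith
  have hlt : (‖x‖ ^ 2 - r ^ 2) / (R ^ 2 - r ^ 2) < 1 / 3 := by
    rw [div_lt_div_iff₀ hden (by norm_num)]
    nlinarith [norm_nonneg x]
  have hcont : Continuous fun x : V => (‖x‖ ^ 2 - r ^ 2) / (R ^ 2 - r ^ 2) := by fun_prop
  filter_upwards [hcont.continuousAt.eventually_lt continuousAt_const hlt] with y hy
  exact stepDown_eq_one hy.le

lemma radialCut_eventuallyEq_zero {r R : ℝ} (hr : 0 < r) (hrR : r < R) {x : V} (hx : R ≤ ‖x‖) :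
    radialCut V r R =ᶠ[nhds x] fun _ => 0 := by
  have hden : 0 < R ^ 2 - r ^ 2 := by nlinarith
  have hlt : 2 / 3 < (‖x‖ ^ 2 - r ^ 2) / (R ^ 2 - r ^ 2) := by
    rw [div_lt_div_iff₀ (by norm_num) hden]
    nlinarith [norm_nonneg x]
  have hcont : Continuous fun x : V => (‖x‖ ^ 2 - r ^ 2) / (R ^ 2 - r ^ 2) := by fun_prop
  filter_upwards [continuousAt_const.eventually_lt hcont.continuousAt hlt] with y hy
  exact stepDown_eq_zero hy.le

lemma radialCut_eq_one {r R : ℝ} (hr : 0 < r) (hrR : r < R) {x : V} (hx : ‖x‖ ≤ r) :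
    radialCut V r R x = 1 := (radialCut_eventuallyEq_one hr hrR hx).eq_of_nhds

lemma radialCut_eq_zero {r R : ℝ} (hr : 0 < r) (hrR : r < R) {x : V} (hx : R ≤ ‖x‖) :
    radialCut V r R x = 0 := (radialCut_eventuallyEq_zero hr hrR hx).eq_of_nhds

variable [InnerProductSpace ℝ V]

lemma norm_iteratedFDeriv_norm_sq_affine_le {r R : ℝ} (hr : 0 < r) (hrR : r < R) {x : V}
    (hx : ‖x‖ ≤ R) {i : ℕ} (hi : 1 ≤ i) :
    ‖iteratedFDeriv ℝ i (fun x : V => (‖x‖ ^ 2 - r ^ 2) / (R ^ 2 - r ^ 2)) x‖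
      ≤ (2 / (R - r)) ^ i := by
  set c : ℝ := 2 / (R ^ 2 - r ^ 2) with hc
  have hden : 0 < R ^ 2 - r ^ 2 := by nlinarith
  have hc0 : 0 < c := by positivity
  have hRr : 0 < R - r := sub_pos.2 hrR
  have hf : fderiv ℝ (fun x : V => (‖x‖ ^ 2 - r ^ 2) / (R ^ 2 - r ^ 2))
      = ⇑(c • (innerSL ℝ : V →L[ℝ] V →L[ℝ] ℝ)) := by
    ext1 y
    have h1 := ((hasStrictFDerivAt_norm_sq y).hasFDerivAt.sub_const (r ^ 2)).mul_const
      ((R ^ 2 - r ^ 2)⁻¹)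
    simp only [div_eq_mul_inv]
    rw [h1.fderiv, hc]
    ext z
    simp
    ring
  obtain ⟨j, rfl⟩ : ∃ j, i = j + 1 := ⟨i - 1, by omega⟩
  rw [← norm_iteratedFDeriv_fderiv, hf]
  have hnorm : ‖(innerSL ℝ : V →L[ℝ] V →L[ℝ] ℝ)‖ ≤ 1 := norm_innerSL_le ℝ
  match j with
  | 0 =>
    simp only [norm_iteratedFDeriv_zero, smul_apply, norm_smul, innerSL_apply_norm,
      zero_add, pow_one]
    rw [Real.norm_of_nonneg hc0.le, hc, div_mul_eq_mul_div, div_le_div_iff₀ hden hRr]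
    nlinarith
  | 1 =>
    rw [← norm_iteratedFDeriv_fderiv, norm_iteratedFDeriv_zero, ContinuousLinearMap.fderiv, norm_smul,
      Real.norm_of_nonneg hc0.le]
    calc c * ‖(innerSL ℝ : V →L[ℝ] V →L[ℝ] ℝ)‖ ≤ c * 1 := by gcongr
      _ ≤ (2 / (R - r)) ^ (1 + 1) := by
        rw [mul_one, hc, div_pow, div_le_div_iff₀ hden (by positivity)]
        rw [one_add_one_eq_two]
        nlinarith [mul_pos hr hRr, mul_pos hRr hRr]
  | l + 2 =>
    rw [← norm_iteratedFDeriv_fderiv]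
    have : fderiv ℝ ⇑(c • (innerSL ℝ : V →L[ℝ] V →L[ℝ] ℝ))
        = fun _ => (c • (innerSL ℝ : V →L[ℝ] V →L[ℝ] ℝ)) := by
      ext1 y
      exact ContinuousLinearMap.fderiv _
    rw [this, iteratedFDeriv_succ_const]
    simp only [Pi.zero_apply, norm_zero]
    positivity

lemma radialCut_contDiff (r R : ℝ) : ContDiff ℝ (⊤ : ℕ∞) (radialCut V r R) :=
  stepDown_contDiff.comp (((contDiff_norm_sq ℝ).sub contDiff_const).div_const _)

lemma iteratedFDeriv_radialCut_eq_zero {r R : ℝ} (hr : 0 < r) (hrR : r < R) {x : V}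
    (hx : ‖x‖ ≤ r ∨ R ≤ ‖x‖) {m : ℕ} (hm : 1 ≤ m) :
    iteratedFDeriv ℝ m (radialCut V r R) x = 0 := by
  obtain ⟨j, rfl⟩ : ∃ j, m = j + 1 := ⟨m - 1, by omega⟩
  rcases hx with hx | hx
  · rw [((radialCut_eventuallyEq_one hr hrR hx).iteratedFDeriv ℝ _).eq_of_nhds,
      iteratedFDeriv_succ_const]
    rfl
  · rw [((radialCut_eventuallyEq_zero hr hrR hx).iteratedFDeriv ℝ _).eq_of_nhds,
      iteratedFDeriv_succ_const]
    rfl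

lemma exists_bound_iteratedFDeriv_radialCut (V : Type*) [NormedAddCommGroup V]
    [InnerProductSpace ℝ V] {m : ℕ} (hm : 1 ≤ m) :
    ∃ C : ℝ, 0 ≤ C ∧ ∀ r R : ℝ, 0 < r → r < R → ∀ x : V,
      ‖iteratedFDeriv ℝ m (radialCut V r R) x‖ ≤ C / (R - r) ^ m := by
  obtain ⟨C, hC0, hC⟩ := exists_bound_iteratedFDeriv_stepDown m
  refine ⟨m.factorial * C * 2 ^ m, by positivity, fun r R hr hrR x => ?_⟩
  have hRr : 0 < R - r := sub_pos.2 hrR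
  by_cases hx : ‖x‖ ≤ r ∨ R ≤ ‖x‖
  · rw [iteratedFDeriv_radialCut_eq_zero hr hrR hx hm, norm_zero]
    positivity
  · push Not at hx
    have hden : 0 < R ^ 2 - r ^ 2 := by nlinarith
    have := norm_iteratedFDeriv_comp_le (n := m) stepDown_contDiff
      (f := fun x : V => (‖x‖ ^ 2 - r ^ 2) / (R ^ 2 - r ^ 2)) (N := (⊤ : ℕ∞))
      (((contDiff_norm_sq ℝ).sub contDiff_const).div_const _) (by exact_mod_cast le_top) x
      (C := C) (D := 2 / (R - r))
      (fun i hi => hC i hi _ ⟨div_nonneg (by nlinarith) hden.le,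
        (div_le_one hden).2 (by nlinarith [norm_nonneg x])⟩)
      (fun i hi _ => norm_iteratedFDeriv_norm_sq_affine_le hr hrR hx.2.le hi)
    refine this.trans (le_of_eq ?_)
    rw [div_pow]
    ring

end Cutoff

section TestFunction

lemma spDeriv_iteratedFDeriv_mul {n : ℕ} {ψ : Spc n → ℝ} (hψ : ContDiff ℝ (⊤ : ℕ∞) ψ) (η : ℝ → ℝ)
    (i : Fin n) (j : ℕ) (v : Fin j → Spc n) :
    spDeriv n i (fun z => iteratedFDeriv ℝ j ψ z.1 v * η z.2)
      = fun z => iteratedFDeriv ℝ (j + 1) ψ z.1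
          (Fin.cons (EuclideanSpace.single i (1 : ℝ)) v : Fin (j + 1) → Spc n) * η z.2 := by
  funext z
  set e : Spc n := EuclideanSpace.single i (1 : ℝ)
  have hd : DifferentiableAt ℝ (iteratedFDeriv ℝ j ψ) z.1 :=
    (hψ.differentiable_iteratedFDeriv (by exact_mod_cast ENat.natCast_lt_top j)).differentiableAt
  have hline : HasDerivAt (fun s : ℝ => z.1 + s • e) e 0 := by
    simpa using ((hasDerivAt_id (0 : ℝ)).smul_const e).const_add z.1
  have hd' : HasFDerivAt (iteratedFDeriv ℝ j ψ) (fderiv ℝ (iteratedFDeriv ℝ j ψ) z.1)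
      (z.1 + (0 : ℝ) • e) := by
    simpa using hd.hasFDerivAt
  have h1 := hd'.comp_hasDerivAt (0 : ℝ) hline
  have h2 := ((ContinuousMultilinearMap.apply ℝ (fun _ : Fin j => Spc n) ℝ v).hasFDerivAt).comp_hasDerivAt
    (0 : ℝ) h1
  have h3 := h2.mul_const (η z.2)
  rw [iteratedFDeriv_succ_apply_left]
  exact h3.deriv

lemma exists_mDeriv_mul_eq {n : ℕ} {ψ : Spc n → ℝ} (hψ : ContDiff ℝ (⊤ : ℕ∞) ψ) (η : ℝ → ℝ)
    (α : Fin n → ℕ) :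
    ∃ v : Fin (∑ i, α i) → Spc n, (∀ i, ‖v i‖ ≤ 1) ∧
      mDeriv n α (fun z => ψ z.1 * η z.2)
        = fun z => iteratedFDeriv ℝ (∑ i, α i) ψ z.1 v * η z.2 := by
  have hstep : ∀ (i : Fin n) (l j : ℕ) (v : Fin j → Spc n), (∀ q, ‖v q‖ ≤ 1) →
      ∃ w : Fin (l + j) → Spc n, (∀ q, ‖w q‖ ≤ 1) ∧
        (spDeriv n i)^[l] (fun z => iteratedFDeriv ℝ j ψ z.1 v * η z.2)
          = fun z => iteratedFDeriv ℝ (l + j) ψ z.1 w * η z.2 := by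
    intro i l j v hv
    induction l with
    | zero => rw [zero_add]; exact ⟨v, hv, rfl⟩
    | succ l ih =>
      obtain ⟨w, hw, hw'⟩ := ih
      rw [Function.iterate_succ_apply', hw', spDeriv_iteratedFDeriv_mul hψ, add_right_comm]
      refine ⟨_, ?_, rfl⟩
      intro q
      refine Fin.cases ?_ (fun q => ?_) q
      · simp
      · simpa using hw q
  have hlist : ∀ L : List (Fin n), ∃ v : Fin (L.map α).sum → Spc n, (∀ i, ‖v i‖ ≤ 1) ∧
      L.foldr (fun i ψ => (spDeriv n i)^[α i] ψ) (fun z => ψ z.1 * η z.2)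
        = fun z => iteratedFDeriv ℝ (L.map α).sum ψ z.1 v * η z.2 := by
    intro L
    induction L with
    | nil =>
      refine ⟨fun _ => 0, fun _ => by simp, ?_⟩
      change (fun z : Spc n × ℝ => ψ z.1 * η z.2) = fun z => iteratedFDeriv ℝ 0 ψ z.1 (fun _ => 0) * η z.2
      simp only [iteratedFDeriv_zero_apply]
    | cons i L ih =>
      obtain ⟨v, hv, hv'⟩ := ih
      rw [List.foldr_cons, hv', List.map_cons, List.sum_cons]
      exact hstep i (α i) _ v hv
  have hsum : ((List.finRange n).map α).sum = ∑ i, α i := by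
    rw [← List.ofFn_eq_map, List.sum_ofFn]
  have := hlist (List.finRange n)
  rw [hsum] at this
  exact this

lemma abs_mDeriv_mul_le {n : ℕ} {ψ : Spc n → ℝ} (hψ : ContDiff ℝ (⊤ : ℕ∞) ψ) (η : ℝ → ℝ)
    (α : Fin n → ℕ) (z : Spc n × ℝ) :
    |mDeriv n α (fun z => ψ z.1 * η z.2) z| ≤ ‖iteratedFDeriv ℝ (∑ i, α i) ψ z.1‖ * |η z.2| := by
  obtain ⟨v, hv, h⟩ := exists_mDeriv_mul_eq hψ η α
  rw [h, abs_mul]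
  gcongr
  refine ((iteratedFDeriv ℝ (∑ i, α i) ψ z.1).le_opNorm v).trans ?_
  exact mul_le_of_le_one_right (norm_nonneg _)
    (Finset.prod_le_one (fun _ _ => norm_nonneg _) fun i _ => hv i)

lemma iterate_tDeriv_mul {n : ℕ} (ψ : Spc n → ℝ) (η : ℝ → ℝ) (j : ℕ) :
    (tDeriv n)^[j] (fun z => ψ z.1 * η z.2) = fun z => ψ z.1 * iteratedDeriv j η z.2 := by
  induction j with
  | zero => simp
  | succ j ih =>
    rw [Function.iterate_succ_apply', ih]
    funext z
    simp only [tDeriv, deriv_const_mul_field', iteratedDeriv_succ]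

/-- The test function cutting off from the cylinder `B_r × (0,t)` to `B_R × (0,T)`. -/
def cutFn (n : ℕ) (r R t T : ℝ) (z : Spc n × ℝ) : ℝ :=
  radialCut (Spc n) r R z.1 * radialCut ℝ t T z.2

lemma cutFn_contDiff (n : ℕ) (r R t T : ℝ) : ContDiff ℝ (⊤ : ℕ∞) (cutFn n r R t T) :=
  ((radialCut_contDiff r R).comp contDiff_fst).mul ((radialCut_contDiff t T).comp contDiff_snd)

lemma cutFn_nonneg (n : ℕ) (r R t T : ℝ) (z : Spc n × ℝ) : 0 ≤ cutFn n r R t T z :=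
  mul_nonneg (radialCut_nonneg _ _ _) (radialCut_nonneg _ _ _)

lemma cutFn_le_one (n : ℕ) (r R t T : ℝ) (z : Spc n × ℝ) : cutFn n r R t T z ≤ 1 :=
  mul_le_one₀ (radialCut_le_one _ _ _) (radialCut_nonneg _ _ _) (radialCut_le_one _ _ _)

lemma cutFn_hasCompactSupport (n : ℕ) {r R t T : ℝ} (hr : 0 < r) (hrR : r < R) (ht : 0 < t)
    (htT : t < T) : HasCompactSupport (cutFn n r R t T) := by
  refine HasCompactSupport.intro
    ((isCompact_closedBall (0 : Spc n) R).prod (isCompact_closedBall (0 : ℝ) T)) fun z hz => ?_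
  rw [Set.mem_prod, not_and_or] at hz
  rcases hz with hz | hz
  · rw [cutFn, radialCut_eq_zero hr hrR, zero_mul]
    simpa using (not_le.1 (by simpa using hz)).le
  · rw [cutFn, radialCut_eq_zero ht htT, mul_zero]
    simpa using (not_le.1 (by simpa using hz)).le

lemma exists_stepDown_superlevel {s : ℝ} (hs0 : 0 ≤ s) (hs1 : s < 1) :
    ∃ y₀, 0 ≤ y₀ ∧ ∀ y, s < stepDown y ↔ y < y₀ := by
  set S : Set ℝ := {y | stepDown y ≤ s} with hS
  have hcl : IsClosed S := isClosed_le stepDown_contDiff.continuous continuous_const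
  have hne : S.Nonempty := ⟨1, by
    rw [hS, mem_ofPred_eq, stepDown_eq_zero (by norm_num)]; exact hs0⟩
  have hlb : ∀ y ∈ S, (0 : ℝ) ≤ y := fun y hy => by
    by_contra! h
    have : stepDown y ≤ s := hy
    rw [stepDown_eq_one (by linarith)] at this
    linarith
  have hbdd : BddBelow S := ⟨0, hlb⟩
  refine ⟨sInf S, le_csInf hne hlb, fun y => ⟨fun h => ?_, fun h => ?_⟩⟩
  · by_contra! hy
    exact absurd ((stepDown_antitone hy).trans (hcl.csInf_mem hne hbdd)) (not_le.2 h)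
  · by_contra! hy
    exact absurd (csInf_le hbdd hy) (not_le.2 h)

lemma integral_Ioo_indicator_lt {c : ℝ} (h0 : 0 ≤ c) (h1 : c ≤ 1) :
    ∫ s in Ioo (0 : ℝ) 1, (if s < c then (1 : ℝ) else 0) = c := by
  have h : (fun s : ℝ => if s < c then (1 : ℝ) else 0) = (Iio c).indicator (fun _ => (1 : ℝ)) := by
    ext s; simp [Set.indicator_apply]
  rw [h, setIntegral_indicator measurableSet_Iio, setIntegral_const]
  have : Ioo (0 : ℝ) 1 ∩ Iio c = Ioo 0 c := by
    ext s; simp only [mem_inter_iff, mem_Ioo, mem_Iio]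
    constructor
    · rintro ⟨⟨a, _⟩, b⟩; exact ⟨a, b⟩
    · rintro ⟨a, b⟩; exact ⟨⟨a, by linarith⟩, b⟩
  rw [this]
  simp [h0]

/-- A function whose integrals over all large balls are nonnegative has nonnegative integral
against the radial cutoffs. -/
lemma integral_mul_radialCut_nonneg {n : ℕ} {v : Spc n → ℝ} {ρ r R : ℝ} (hρ : 0 < ρ)
    (hv : ∀ R : ℝ, 0 < R → IntegrableOn v (ball0 n R))
    (hU : ∀ r ∈ Ici ρ, 0 ≤ ∫ x in ball0 n r, v x) (hr : ρ ≤ r) (hrR : r < R) :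
    0 ≤ ∫ x, v x * radialCut (Spc n) r R x := by
  have hr0 : 0 < r := hρ.trans_le hr
  have hden : 0 < R ^ 2 - r ^ 2 := by nlinarith
  have hsupp : ∫ x, v x * radialCut (Spc n) r R x
      = ∫ x in ball0 n R, v x * radialCut (Spc n) r R x := by
    refine (setIntegral_eq_integral_of_forall_compl_eq_zero fun x hx => ?_).symm
    rw [radialCut_eq_zero hr0 hrR (by simpa [ball0] using hx), mul_zero]
  have hlayer : ∀ x, v x * radialCut (Spc n) r R x
      = ∫ s in Ioo (0 : ℝ) 1, v x * (if s < radialCut (Spc n) r R x then (1 : ℝ) else 0) := by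
    intro x
    rw [integral_const_mul, integral_Ioo_indicator_lt (radialCut_nonneg _ _ _) (radialCut_le_one _ _ _)]
  have hint : Integrable (Function.uncurry fun (x : Spc n) (s : ℝ) =>
      v x * (if s < radialCut (Spc n) r R x then (1 : ℝ) else 0))
      ((volume.restrict (ball0 n R)).prod (volume.restrict (Ioo (0 : ℝ) 1))) := by
    have h1 : Integrable (fun z : Spc n × ℝ => v z.1)
        ((volume.restrict (ball0 n R)).prod (volume.restrict (Ioo (0 : ℝ) 1))) :=
      (hv R (hr0.trans hrR)).comp_fst _
    refine h1.mul_bdd (c := 1) ?_ (ae_of_all _ fun z => ?_)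
    · refine Measurable.aestronglyMeasurable (Measurable.ite ?_ measurable_const measurable_const)
      exact measurableSet_lt measurable_snd
        ((radialCut_contDiff r R).continuous.measurable.comp measurable_fst)
    · split_ifs <;> simp
  rw [hsupp]
  simp_rw [hlayer]
  rw [integral_integral_swap hint]
  refine setIntegral_nonneg measurableSet_Ioo fun s hs => ?_
  obtain ⟨y₀, hy₀, hy⟩ := exists_stepDown_superlevel hs.1.le hs.2
  set d : ℝ := √(r ^ 2 + y₀ * (R ^ 2 - r ^ 2)) with hd
  have hd0 : r ≤ d := Real.le_sqrt_of_sq_le (by nlinarith [mul_nonneg hy₀ hden.le])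
  have hiff : ∀ x : Spc n, s < radialCut (Spc n) r R x ↔ x ∈ ball0 n d := by
    intro x
    rw [radialCut, hy, div_lt_iff₀ hden, ball0, mem_ball_zero_iff, hd,
      Real.lt_sqrt (norm_nonneg x), sub_lt_iff_lt_add']
  have hsub : ball0 n d ⊆ ball0 n R := by
    intro x hx
    by_contra h
    have := (hiff x).2 hx
    rw [radialCut_eq_zero hr0 hrR (by simpa [ball0] using h)] at this
    exact absurd hs.1 (not_lt.2 this.le)
  have heq : (fun x => v x * (if s < radialCut (Spc n) r R x then (1 : ℝ) else 0))
      = (ball0 n d).indicator v := by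
    ext x
    by_cases hx : x ∈ ball0 n d
    · rw [if_pos ((hiff x).2 hx), mul_one, indicator_of_mem hx]
    · rw [if_neg (fun h => hx ((hiff x).1 h)), mul_zero, indicator_of_notMem hx]
  rw [heq, setIntegral_indicator (show MeasurableSet (ball0 n d) from
    Metric.isOpen_ball.measurableSet), inter_eq_self_of_subset_right hsub]
  exact hU d (hr.trans hd0)

end TestFunction

section EnergyEstimate

/-- The cylinder `B_R × (0,T)`. -/
def box (n : ℕ) (R T : ℝ) : Set (Spc n × ℝ) := ball0 n R ×ˢ Ioo 0 T

lemma mem_box {n : ℕ} {R T : ℝ} {z : Spc n × ℝ} :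
    z ∈ box n R T ↔ ‖z.1‖ < R ∧ 0 < z.2 ∧ z.2 < T := by
  simp [box, ball0, Set.mem_prod]

lemma measurableSet_box (n : ℕ) (R T : ℝ) : MeasurableSet (box n R T) :=
  Metric.isOpen_ball.measurableSet.prod measurableSet_Ioo

lemma measurableSet_halfSp (n : ℕ) : MeasurableSet (halfSp n) :=
  measurableSet_lt measurable_const measurable_snd

lemma box_subset_halfSp (n : ℕ) (R T : ℝ) : box n R T ⊆ halfSp n := fun _ hz => (mem_box.1 hz).2.1

lemma box_mono {n : ℕ} {r R t T : ℝ} (h : r ≤ R) (h' : t ≤ T) : box n r t ⊆ box n R T :=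
  fun _ hz => mem_box.2 ⟨(mem_box.1 hz).1.trans_le h, (mem_box.1 hz).2.1, (mem_box.1 hz).2.2.trans_le h'⟩

lemma integrableOn_box {n : ℕ} {g : Spc n × ℝ → ℝ}
    (hg : ∀ r : ℝ, 0 < r → IntegrableOn g (cyl n r 1)) (R T : ℝ) : IntegrableOn g (box n R T) := by
  have h : cyl n (max 1 (max R T)) 1 = box n (max 1 (max R T)) (max 1 (max R T)) := by
    rw [cyl, box, Real.rpow_one]
  refine (h ▸ hg (max 1 (max R T)) (by positivity)).mono_set (box_mono ?_ ?_) <;> simp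

lemma volume_real_box {n : ℕ} (hn : 1 ≤ n) {R T : ℝ} (hR : 0 ≤ R) (hT : 0 ≤ T) :
    volume.real (box n R T) = volume.real (ball0 n 1) * (R ^ n * T) := by
  have : Nonempty (Fin n) := ⟨⟨0, hn⟩⟩
  rw [measureReal_def, measureReal_def, box, Measure.volume_eq_prod, Measure.prod_prod, ball0, ball0,
    Measure.addHaar_ball volume 0 hR, Real.volume_Ioo]
  simp only [finrank_euclideanSpace, Fintype.card_fin, sub_zero, ENNReal.toReal_mul]
  rw [ENNReal.toReal_ofReal (by positivity), ENNReal.toReal_ofReal hT]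
  ring

lemma volume_real_ball_one_pos (n : ℕ) : 0 < volume.real (ball0 n 1) :=
  ENNReal.toReal_pos (Metric.measure_ball_pos volume _ one_pos).ne' measure_ball_lt_top.ne

lemma volume_box_lt_top (n : ℕ) (R T : ℝ) : volume (box n R T) < ⊤ := by
  rw [box, Measure.volume_eq_prod, Measure.prod_prod]
  exact ENNReal.mul_lt_top measure_ball_lt_top (by simp)

lemma abs_iteratedDeriv_radialCut (k : ℕ) (t T s : ℝ) :
    |iteratedDeriv k (radialCut ℝ t T) s| = ‖iteratedFDeriv ℝ k (radialCut ℝ t T) s‖ := by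
  rw [norm_iteratedFDeriv_eq_norm_iteratedDeriv, Real.norm_eq_abs]

lemma setIntegral_indicator_halfSp {n : ℕ} {D : Set (Spc n × ℝ)} (hD : MeasurableSet D)
    (hsub : D ⊆ halfSp n) (g : Spc n × ℝ → ℝ) :
    ∫ z in halfSp n, D.indicator g z = ∫ z in D, g z := by
  rw [setIntegral_indicator hD, inter_eq_self_of_subset_right hsub]

/-- If `F` is supported in `D` up to a null set and bounded there by `c * w`, so is its integral. -/
lemma integral_halfSp_abs_le {n : ℕ} {D : Set (Spc n × ℝ)} (hD : MeasurableSet D)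
    (hsub : D ⊆ halfSp n) {F w : Spc n × ℝ → ℝ} (hw : IntegrableOn w D) {c : ℝ}
    (hF : ∀ᵐ z ∂(volume.restrict (halfSp n)), |F z| ≤ D.indicator (fun z => c * w z) z) :
    |∫ z in halfSp n, F z| ≤ c * ∫ z in D, w z := by
  rw [← integral_const_mul, ← setIntegral_indicator_halfSp hD hsub]
  refine norm_integral_le_of_norm_le (f := F) ?_ hF
  exact ((integrable_indicator_iff hD).2 (hw.const_mul c)).integrableOn

lemma integral_initial_term_nonneg {n k : ℕ} (hk : 1 ≤ k) {u0 : ℕ → Spc n → ℝ} {ρ : ℝ} (hρ : 0 < ρ)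
    (hu0 : ∀ i < k, L1locInit n (u0 i))
    (hU : ∀ r ∈ Ici ρ, 0 ≤ ∫ x in ball0 n r, u0 (k - 1) x) {r R t T : ℝ} (hr : ρ ≤ r) (hrR : r < R)
    (ht : 0 < t) (htT : t < T) :
    0 ≤ ∫ x : Spc n, ∑ i ∈ Finset.range k,
      (-1 : ℝ) ^ i * u0 (k - 1 - i) x * (tDeriv n)^[i] (cutFn n r R t T) (x, 0) := by
  have h : ∀ x : Spc n, ∑ i ∈ Finset.range k,
      (-1 : ℝ) ^ i * u0 (k - 1 - i) x * (tDeriv n)^[i] (cutFn n r R t T) (x, 0)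
      = u0 (k - 1) x * radialCut (Spc n) r R x := by
    intro x
    unfold cutFn
    rw [Finset.sum_eq_single_of_mem 0 (Finset.mem_range.2 hk)]
    · simp [radialCut_eq_one ht htT (x := (0 : ℝ)) (by simpa using ht.le)]
    · intro i _ hi
      have h0 : iteratedDeriv i (radialCut ℝ t T) 0 = 0 := by
        rw [← abs_eq_zero, abs_iteratedDeriv_radialCut,
          iteratedFDeriv_radialCut_eq_zero ht htT (Or.inl (by simpa using ht.le))
            (Nat.one_le_iff_ne_zero.2 hi), norm_zero]
      rw [iterate_tDeriv_mul]
      simp only [h0, mul_zero]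
  simp_rw [h]
  exact integral_mul_radialCut_nonneg hρ (hu0 (k - 1) (by omega)) hU hr hrR

/-- The Caccioppoli-type estimate obtained by testing the inequality with the cutoffs. -/
lemma exists_energy_estimate {n k m : ℕ} (hk : 1 ≤ k) (hm : 1 ≤ m)
    {A p : ℝ} (hA : 0 < A)
    {a : (Fin n → ℕ) → Spc n × ℝ → ℝ → ℝ} (ha : GoodCoeffs n m A p a)
    {f : ℝ → ℝ} (hf0 : ∀ ζ, 0 ≤ ζ → 0 ≤ f ζ)
    {u0 : ℕ → Spc n → ℝ} (hu0 : ∀ i < k, L1locInit n (u0 i)) {ρ : ℝ} (hρ : 0 < ρ)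
    (hU : ∀ r ∈ Ici ρ, 0 ≤ ∫ x in ball0 n r, u0 (k - 1) x)
    {u : Spc n × ℝ → ℝ} (hu : IsGlobalWeakSol n k m p a f u0 u) :
    ∃ C : ℝ, 0 < C ∧ ∀ r R t T : ℝ, ρ ≤ r → r < R → 0 < t → t < T →
      ∫ z in box n r t, f |u z| ≤
        C * ((∫ z in box n R T \ box n r t, |u z|) / (T - t) ^ k
          + (∫ z in box n R T \ box n r t, |u z| ^ p) / (R - r) ^ m) := by
  obtain ⟨C₁, hC₁, hη⟩ := exists_bound_iteratedFDeriv_radialCut ℝ hk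
  obtain ⟨C₂, hC₂, hψ⟩ := exists_bound_iteratedFDeriv_radialCut (Spc n) hm
  set N : ℝ := ((mIdx n m).card : ℝ)
  refine ⟨C₁ + N * A * C₂ + 1, by positivity, fun r R t T hr hrR ht htT => ?_⟩
  have hr0 : 0 < r := hρ.trans_le hr
  have hTt : 0 < T - t := sub_pos.2 htT
  have hRr : 0 < R - r := sub_pos.2 hrR
  set D := box n R T \ box n r t with hDdef
  have hD : MeasurableSet D := (measurableSet_box n R T).diff (measurableSet_box n r t)
  have hDsub : D ⊆ halfSp n := sdiff_subset.trans (box_subset_halfSp n R T)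
  have hoff : ∀ z ∈ halfSp n, z ∉ D → R ≤ ‖z.1‖ ∨ T ≤ ‖z.2‖ ∨ (‖z.1‖ ≤ r ∧ ‖z.2‖ ≤ t) := by
    intro z (hz : 0 < z.2) hzD
    rw [Real.norm_of_nonneg hz.le]
    by_contra! h
    refine hzD ⟨mem_box.2 ⟨h.1, hz, h.2.1⟩, fun hz' => ?_⟩
    have h' := mem_box.1 hz'
    linarith [h.2.2 h'.1.le]
  have hiu : IntegrableOn (fun z => |u z|) D :=
    IntegrableOn.mono_set (integrableOn_box hu.1 R T).abs sdiff_subset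
  have hip : IntegrableOn (fun z => |u z| ^ p) D :=
    (integrableOn_box hu.2.1 R T).mono_set sdiff_subset
  have h := hu.2.2.2 (cutFn n r R t T) (cutFn_contDiff n r R t T)
    (cutFn_hasCompactSupport n hr0 hrR ht htT) (cutFn_nonneg n r R t T)
  have hinit := integral_initial_term_nonneg hk hρ hu0 hU hr hrR ht htT
  have htime : |∫ z in halfSp n, (-1 : ℝ) ^ k * u z * (tDeriv n)^[k] (cutFn n r R t T) z|
      ≤ C₁ / (T - t) ^ k * ∫ z in D, |u z| := by
    refine integral_halfSp_abs_le hD hDsub hiu (ae_restrict_of_forall_mem (measurableSet_halfSp n)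
      fun z hz => ?_)
    unfold cutFn
    rw [iterate_tDeriv_mul, abs_mul, abs_mul, abs_neg_one_pow, one_mul, abs_mul,
      abs_iteratedDeriv_radialCut, abs_of_nonneg (radialCut_nonneg _ _ _)]
    by_cases hzD : z ∈ D
    · rw [indicator_of_mem hzD, mul_comm]
      gcongr
      exact (mul_le_of_le_one_left (norm_nonneg _) (radialCut_le_one _ _ _)).trans (hη t T ht htT z.2)
    · rw [indicator_of_notMem hzD]
      refine le_of_eq ?_
      rcases hoff z hz hzD with h | h | h
      · rw [radialCut_eq_zero hr0 hrR h, zero_mul, mul_zero]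
      · rw [iteratedFDeriv_radialCut_eq_zero ht htT (Or.inr h) hk, norm_zero, mul_zero, mul_zero]
      · rw [iteratedFDeriv_radialCut_eq_zero ht htT (Or.inl h.2) hk, norm_zero, mul_zero, mul_zero]
  have hspace : |∫ z in halfSp n, ∑ α ∈ mIdx n m,
      (-1 : ℝ) ^ m * a α z (u z) * mDeriv n α (cutFn n r R t T) z|
      ≤ N * A * C₂ / (R - r) ^ m * ∫ z in D, |u z| ^ p := by
    refine integral_halfSp_abs_le hD hDsub hip ?_
    have hae : ∀ᵐ z ∂(volume.restrict (halfSp n)), ∀ α ∈ mIdx n m, ∀ ζ : ℝ,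
        |a α z ζ| ≤ A * |ζ| ^ p :=
      (ae_ball_iff (mIdx n m).countable_toSet).2 fun α hα => (ha α hα).2.2
    filter_upwards [hae, ae_restrict_mem (measurableSet_halfSp n)] with z hza hz
    have hterm : ∀ α ∈ mIdx n m, |(-1 : ℝ) ^ m * a α z (u z) * mDeriv n α (cutFn n r R t T) z|
        ≤ A * |u z| ^ p * (‖iteratedFDeriv ℝ m (radialCut (Spc n) r R) z.1‖
          * radialCut ℝ t T z.2) := by
      intro α hα
      have hαm : ∑ i, α i = m := (Finset.mem_filter.1 hα).2
      rw [abs_mul, abs_mul, abs_neg_one_pow, one_mul]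
      have h1 := abs_mDeriv_mul_le (radialCut_contDiff (V := Spc n) r R) (radialCut ℝ t T) α z
      rw [hαm, abs_of_nonneg (radialCut_nonneg _ _ _)] at h1
      exact mul_le_mul (hza α hα _) h1 (abs_nonneg _) (by positivity)
    refine (Finset.abs_sum_le_sum_abs _ _).trans ((Finset.sum_le_card_nsmul _ _ _ hterm).trans ?_)
    rw [nsmul_eq_mul]
    by_cases hzD : z ∈ D
    · rw [indicator_of_mem hzD]
      have h1 : ‖iteratedFDeriv ℝ m (radialCut (Spc n) r R) z.1‖ * radialCut ℝ t T z.2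
          ≤ C₂ / (R - r) ^ m :=
        (mul_le_of_le_one_right (norm_nonneg _) (radialCut_le_one _ _ _)).trans (hψ r R hr0 hrR z.1)
      calc N * (A * |u z| ^ p * (‖iteratedFDeriv ℝ m (radialCut (Spc n) r R) z.1‖
            * radialCut ℝ t T z.2)) ≤ N * (A * |u z| ^ p * (C₂ / (R - r) ^ m)) := by gcongr
        _ = N * A * C₂ / (R - r) ^ m * |u z| ^ p := by ring
    · rw [indicator_of_notMem hzD]
      refine le_of_eq ?_
      rcases hoff z hz hzD with h | h | h
      · rw [iteratedFDeriv_radialCut_eq_zero hr0 hrR (Or.inr h) hm, norm_zero, zero_mul, mul_zero,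
          mul_zero]
      · rw [radialCut_eq_zero ht htT h, mul_zero, mul_zero, mul_zero]
      · rw [iteratedFDeriv_radialCut_eq_zero hr0 hrR (Or.inl h.1) hm, norm_zero, zero_mul, mul_zero,
          mul_zero]
  have hfint : IntegrableOn (fun z => f |u z| * cutFn n r R t T z) (halfSp n) := by
    have h1 : IntegrableOn (fun z => f |u z| * cutFn n r R t T z) (box n R T) :=
      (integrableOn_box hu.2.2.1 R T).mul_bdd (c := 1)
        (cutFn_contDiff n r R t T).continuous.aestronglyMeasurable
        (ae_of_all _ fun z => by
          rw [Real.norm_of_nonneg (cutFn_nonneg n r R t T z)]; exact cutFn_le_one n r R t T z)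
    refine h1.of_forall_sdiff_eq_zero (measurableSet_halfSp n) fun z hz => ?_
    have hz0 : 0 < z.2 := hz.1
    have : R ≤ ‖z.1‖ ∨ T ≤ ‖z.2‖ := by
      by_contra! h'
      rw [Real.norm_of_nonneg hz0.le] at h'
      exact hz.2 (mem_box.2 ⟨h'.1, hz0, h'.2⟩)
    rcases this with h' | h'
    · rw [cutFn, radialCut_eq_zero hr0 hrR h', zero_mul, mul_zero]
    · rw [cutFn, radialCut_eq_zero ht htT h', mul_zero, mul_zero]
  have hlow : ∫ z in box n r t, f |u z| ≤ ∫ z in halfSp n, f |u z| * cutFn n r R t T z := by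
    calc ∫ z in box n r t, f |u z| = ∫ z in box n r t, f |u z| * cutFn n r R t T z := by
          refine setIntegral_congr_fun (measurableSet_box n r t) fun z hz => ?_
          have hz' := mem_box.1 hz
          simp only [cutFn]
          rw [radialCut_eq_one hr0 hrR hz'.1.le, radialCut_eq_one ht htT
            (by rw [Real.norm_of_nonneg hz'.2.1.le]; exact hz'.2.2.le), mul_one, mul_one]
      _ ≤ ∫ z in halfSp n, f |u z| * cutFn n r R t T z :=
          setIntegral_mono_set hfint (ae_of_all _ fun z =>
            mul_nonneg (hf0 _ (abs_nonneg _)) (cutFn_nonneg n r R t T z))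
            (box_subset_halfSp n r t).eventuallyLE
  have hIu : 0 ≤ ∫ z in D, |u z| := integral_nonneg fun z => abs_nonneg _
  have hIp : 0 ≤ ∫ z in D, |u z| ^ p := integral_nonneg fun z => by positivity
  have h1 := (le_abs_self _).trans htime
  have h2 := (neg_le_abs _).trans hspace
  calc ∫ z in box n r t, f |u z| ≤ C₁ / (T - t) ^ k * (∫ z in D, |u z|)
        + N * A * C₂ / (R - r) ^ m * ∫ z in D, |u z| ^ p := by linarith
    _ = C₁ * ((∫ z in D, |u z|) / (T - t) ^ k)
        + N * A * C₂ * ((∫ z in D, |u z| ^ p) / (R - r) ^ m) := by ring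
    _ ≤ (C₁ + N * A * C₂ + 1) * ((∫ z in D, |u z|) / (T - t) ^ k)
        + (C₁ + N * A * C₂ + 1) * ((∫ z in D, |u z| ^ p) / (R - r) ^ m) := by
      have : 0 ≤ N * A * C₂ := by positivity
      gcongr <;> linarith
    _ = _ := by ring

end EnergyEstimate

section Convexity

lemma ConvexOn.apply_zero_nonneg {f : ℝ → ℝ} (hc : ConvexOn ℝ (Ici 0) f)
    (hpos : ∀ ζ, 0 < ζ → 0 < f ζ) : 0 ≤ f 0 := by
  by_contra! h
  have h1 := hpos 1 one_pos
  have hd : 0 < f 1 - f 0 := by linarith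
  set x := -f 0 / (f 1 - f 0) with hx
  have hx0 : 0 < x := div_pos (by linarith) hd
  have hx1 : x ≤ 1 := (div_le_one hd).2 (by linarith)
  have h2 := hc.2 (mem_Ici.2 le_rfl) (mem_Ici.2 zero_le_one) (sub_nonneg.2 hx1) hx0.le
    (sub_add_cancel 1 x)
  simp only [smul_eq_mul, mul_zero, mul_one, zero_add] at h2
  have h3 : x * (f 1 - f 0) = -f 0 := div_mul_cancel₀ _ hd.ne'
  nlinarith [hpos x hx0]

lemma ConvexOn.continuousOn_Ici_of_monotoneOn {g : ℝ → ℝ} (hc : ConvexOn ℝ (Ici 0) g)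
    (hm : MonotoneOn g (Ici 0)) : ContinuousOn g (Ici 0) := by
  intro x hx
  rcases (mem_Ici.1 hx).eq_or_lt with rfl | hx0
  · have hlim : Tendsto (fun y : ℝ => (1 - y) * g 0 + y * g 1) (nhdsWithin 0 (Ici 0)) (nhds (g 0)) := by
      have : Continuous fun y : ℝ => (1 - y) * g 0 + y * g 1 := by fun_prop
      simpa using (this.tendsto 0).mono_left nhdsWithin_le_nhds
    refine tendsto_of_tendsto_of_tendsto_of_le_of_le' tendsto_const_nhds hlim ?_ ?_
    · filter_upwards [self_mem_nhdsWithin] with y hy using hm hx hy hy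
    · have h1 : ∀ᶠ y in nhdsWithin (0 : ℝ) (Ici 0), y ≤ 1 :=
        nhdsWithin_le_nhds (Iic_mem_nhds zero_lt_one)
      filter_upwards [self_mem_nhdsWithin, h1] with y hy hy1
      have h2 := hc.2 hx (mem_Ici.2 zero_le_one) (sub_nonneg.2 hy1) hy (sub_add_cancel 1 y)
      simpa using h2
  · have := hc.continuousOn_interior
    rw [interior_Ici] at this
    exact (this.continuousAt (Ioi_mem_nhds hx0)).continuousWithinAt

/-- Jensen's inequality in the form of a bound on the integral of `w`. -/
lemma setIntegral_le_of_setIntegral_comp_lt {X : Type*} [MeasurableSpace X] {μ : Measure X}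
    {g : ℝ → ℝ} (hc : ConvexOn ℝ (Ici 0) g) (hm : MonotoneOn g (Ici 0)) {D : Set X} (hD : μ D ≠ ⊤)
    {w : X → ℝ} (hw0 : ∀ x, 0 ≤ w x) (hw : IntegrableOn w D μ)
    (hgw : IntegrableOn (fun x => g (w x)) D μ) {b : ℝ} (hb : 0 ≤ b)
    (h : ∫ x in D, g (w x) ∂μ < μ.real D * g b) : ∫ x in D, w x ∂μ ≤ μ.real D * b := by
  have hD0 : μ D ≠ 0 := by
    intro h0
    simp [Measure.restrict_eq_zero.2 h0, measureReal_def, h0] at h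
  have hr : 0 < μ.real D := ENNReal.toReal_pos hD0 hD
  by_contra! hlt
  have hJ := hc.map_set_average_le (hc.continuousOn_Ici_of_monotoneOn hm) isClosed_Ici hD0 hD
    (ae_of_all _ hw0) hw hgw
  rw [setAverage_eq, setAverage_eq, smul_eq_mul, smul_eq_mul] at hJ
  have hb' : b ≤ (μ.real D)⁻¹ * ∫ x in D, w x ∂μ := by
    rw [inv_mul_eq_div, le_div_iff₀ hr, mul_comm]; exact hlt.le
  have h1 := (hm hb (hb.trans hb') hb').trans hJ
  rw [inv_mul_eq_div, le_div_iff₀ hr] at h1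
  linarith

end Convexity


section KeyEstimate

lemma GoodF.nonneg {p : ℝ} {f : ℝ → ℝ} (hf : GoodF p f) {ζ : ℝ} (hζ : 0 ≤ ζ) : 0 ≤ f ζ :=
  (hf.2.1.apply_zero_nonneg hf.2.2.2.2).trans (hf.1 (mem_Ici.2 le_rfl) hζ hζ)

/-- Combination of the energy estimate with Jensen's inequality: a small mean value of `f |u|` over
a layer bounds the energy of the inner cylinder. -/
lemma exists_energy_le_of_layer_lt {n k m : ℕ} (hk : 1 ≤ k) (hm : 1 ≤ m)
    {A p : ℝ} (hA : 0 < A) (hp : 0 < p)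
    {a : (Fin n → ℕ) → Spc n × ℝ → ℝ → ℝ} (ha : GoodCoeffs n m A p a)
    {f : ℝ → ℝ} (hf : GoodF p f) {u0 : ℕ → Spc n → ℝ} (hu0 : ∀ i < k, L1locInit n (u0 i))
    {ρ : ℝ} (hρ : 0 < ρ) (hU : ∀ r ∈ Ici ρ, 0 ≤ ∫ x in ball0 n r, u0 (k - 1) x)
    {u : Spc n × ℝ → ℝ} (hu : IsGlobalWeakSol n k m p a f u0 u) :
    ∃ C, 0 < C ∧ ∀ r R t T b, ρ ≤ r → r < R → 0 < t → t < T → 0 ≤ b →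
      ∀ S : Set (Spc n × ℝ), MeasurableSet S → box n R T \ box n r t ⊆ S → S ⊆ box n R T →
      ∫ z in S, f |u z| < volume.real S * f b →
      ∫ z in box n r t, f |u z| ≤
        C * (volume.real S * (b / (T - t) ^ k + b ^ p / (R - r) ^ m)) := by
  obtain ⟨C, hC, hE⟩ := exists_energy_estimate hk hm hA ha (fun ζ hζ => hf.nonneg hζ) hu0 hρ hU hu
  refine ⟨C, hC, fun r R t T b hr hrR ht htT hb S hSm hS1 hS2 hlt => ?_⟩
  have hS : volume S ≠ ⊤ := ((measure_mono hS2).trans_lt (volume_box_lt_top n R T)).ne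
  have hi1 : IntegrableOn (fun z => |u z|) S := ((integrableOn_box hu.1 R T).mono_set hS2).abs
  have hip : IntegrableOn (fun z => |u z| ^ p) S := (integrableOn_box hu.2.1 R T).mono_set hS2
  have hif : IntegrableOn (fun z => f |u z|) S := (integrableOn_box hu.2.2.1 R T).mono_set hS2
  have hinv : ∀ x : ℝ, 0 ≤ x → (x ^ p) ^ (1 / p) = x := fun x hx => by
    rw [← Real.rpow_mul hx, mul_one_div_cancel hp.ne', Real.rpow_one]
  have h1 : ∫ z in S, |u z| ≤ volume.real S * b :=
    setIntegral_le_of_setIntegral_comp_lt hf.2.1 hf.1 hS (fun z => abs_nonneg _) hi1 hif hb hlt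
  have h2 : ∫ z in S, |u z| ^ p ≤ volume.real S * b ^ p := by
    refine setIntegral_le_of_setIntegral_comp_lt hf.2.2.2.1 hf.2.2.1 hS
      (fun z => by positivity) hip ?_ (by positivity) ?_
    · simpa only [hinv _ (abs_nonneg _)] using hif
    · simpa only [hinv _ (abs_nonneg _), hinv _ hb] using hlt
  have h3 : ∫ z in box n R T \ box n r t, |u z| ≤ ∫ z in S, |u z| :=
    setIntegral_mono_set hi1 (ae_of_all _ fun z => abs_nonneg _) hS1.eventuallyLE
  have h4 : ∫ z in box n R T \ box n r t, |u z| ^ p ≤ ∫ z in S, |u z| ^ p :=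
    setIntegral_mono_set hip (ae_of_all _ fun z => by simp only [Pi.zero_apply]; positivity)
      hS1.eventuallyLE
  have ht' : 0 < T - t := sub_pos.2 htT
  have hr' : 0 < R - r := sub_pos.2 hrR
  refine (hE r R t T hr hrR ht htT).trans ?_
  gcongr
  rw [mul_add, ← mul_div_assoc, ← mul_div_assoc]
  gcongr
  · exact h3.trans h1
  · exact h4.trans h2

lemma energy_mono {n k m : ℕ} {p : ℝ} {a : (Fin n → ℕ) → Spc n × ℝ → ℝ → ℝ} {f : ℝ → ℝ}
    (hf : GoodF p f) {u0 : ℕ → Spc n → ℝ} {u : Spc n × ℝ → ℝ}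
    (hu : IsGlobalWeakSol n k m p a f u0 u) {r R t T : ℝ} (h : r ≤ R) (h' : t ≤ T) :
    ∫ z in box n r t, f |u z| ≤ ∫ z in box n R T, f |u z| :=
  setIntegral_mono_set (integrableOn_box hu.2.2.1 R T)
    (ae_of_all _ fun _ => hf.nonneg (abs_nonneg _)) (box_mono h h').eventuallyLE

/-- A nontrivial solution has positive energy in some large cylinder. -/
lemma exists_energy_pos {n k m : ℕ} {p : ℝ} {a : (Fin n → ℕ) → Spc n × ℝ → ℝ → ℝ} {f : ℝ → ℝ}
    (hf : GoodF p f) {u0 : ℕ → Spc n → ℝ} {u : Spc n × ℝ → ℝ}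
    (hu : IsGlobalWeakSol n k m p a f u0 u) (hnt : ¬ TrivialSol n u) (ρ : ℝ) {κ : ℝ} (hκ : 0 < κ) :
    ∃ R, ρ ≤ R ∧ 1 ≤ R ∧ 0 < ∫ z in box n R (R ^ κ), f |u z| := by
  by_contra! hcon
  refine hnt ?_
  have hun : halfSp n ⊆ ⋃ j : ℕ, box n (j + max ρ 1) ((j + max ρ 1) ^ κ) := fun z hz => by
    have hlim : Tendsto (fun j : ℕ => (j : ℝ) + max ρ 1) atTop atTop :=
      tendsto_atTop_add_const_right _ _ tendsto_natCast_atTop_atTop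
    have h1 := hlim.eventually_gt_atTop ‖z.1‖
    have h2 := ((tendsto_rpow_atTop hκ).comp hlim).eventually_gt_atTop z.2
    obtain ⟨j, hj1, hj2⟩ := (h1.and h2).exists
    exact mem_iUnion.2 ⟨j, mem_box.2 ⟨hj1, hz, hj2⟩⟩
  refine ae_restrict_of_ae_restrict_of_subset hun ((ae_restrict_iUnion_iff _ _).2 fun j => ?_)
  have hj0 : (0 : ℝ) ≤ j := j.cast_nonneg
  have hle := hcon (j + max ρ 1) (by linarith [le_max_left ρ 1]) (by linarith [le_max_right ρ 1])
  have h0 : 0 ≤ᵐ[volume.restrict (box n (j + max ρ 1) ((j + max ρ 1) ^ κ))] fun z => f |u z| :=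
    ae_of_all _ fun _ => hf.nonneg (abs_nonneg _)
  have := (integral_eq_zero_iff_of_nonneg_ae h0 (integrableOn_box hu.2.2.1 _ _)).1
    (hle.antisymm (integral_nonneg_of_ae h0))
  filter_upwards [this] with z hz
  by_contra hne
  exact (hf.2.2.2.2 _ (abs_pos.2 hne)).ne' hz

end KeyEstimate

section KellerOsserman

lemma summable_dyadic_of_integrableOn {f : ℝ → ℝ} (hm : MonotoneOn f (Ici 0))
    (hpos : ∀ ζ, 0 < ζ → 0 < f ζ) {q l : ℝ} (hq : 0 < q) (hl : 0 < l)
    (hint : IntegrableOn (fun ζ : ℝ => ζ ^ (q - 1) / f ζ ^ l) (Ioi 1)) :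
    Summable fun j : ℕ => ((2 : ℝ) ^ j) ^ q / f (2 ^ j) ^ l := by
  set h : ℝ → ℝ := fun ζ => ζ ^ (q - 1) / f ζ ^ l
  have hmono2 : Monotone fun j : ℕ => (2 : ℝ) ^ j := pow_right_mono₀ one_le_two
  have hdisj : Pairwise (Function.onFun Disjoint fun j : ℕ => Ioc ((2 : ℝ) ^ j) (2 ^ (j + 1))) :=
    hmono2.pairwise_disjoint_on_Ioc_succ
  have hsub : (⋃ j : ℕ, Ioc ((2 : ℝ) ^ j) (2 ^ (j + 1))) ⊆ Ioi 1 :=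
    iUnion_subset fun j x hx => (one_le_pow₀ one_le_two).trans_lt hx.1
  have hsum : Summable fun j : ℕ => ∫ ζ in Ioc ((2 : ℝ) ^ j) (2 ^ (j + 1)), h ζ :=
    (hasSum_integral_iUnion (fun _ => measurableSet_Ioc) hdisj (hint.mono_set hsub)).summable
  refine (summable_nat_add_iff 1).1
    (Summable.of_nonneg_of_le (fun j => ?_) (fun j => ?_) (hsum.mul_left (2 * 2 ^ q)))
  · have := hpos (2 ^ (j + 1)) (by positivity)
    positivity
  have hj : (0 : ℝ) < 2 ^ j := by positivity
  have hfj := hpos (2 ^ (j + 1)) (by positivity)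
  have hle : ∀ ζ ∈ Ioc ((2 : ℝ) ^ j) (2 ^ (j + 1)),
      (2 ^ j) ^ q / 2 ^ (j + 1) / f (2 ^ (j + 1)) ^ l ≤ h ζ := fun ζ hζ => by
    have hζ0 : 0 < ζ := hj.trans hζ.1
    have hfζ := hpos ζ hζ0
    have h1 : f ζ ≤ f (2 ^ (j + 1)) := hm hζ0.le (hζ0.le.trans hζ.2) hζ.2
    simp only [h]
    rw [Real.rpow_sub_one hζ0.ne']
    have h2 := hζ.1.le
    have h3 := hζ.2
    gcongr
  have h4 := setIntegral_mono_on (integrableOn_const (by simp)) (hint.mono_set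
    ((subset_iUnion (fun j : ℕ => Ioc ((2 : ℝ) ^ j) (2 ^ (j + 1))) j).trans hsub))
    measurableSet_Ioc hle
  rw [setIntegral_const, measureReal_def, Real.volume_Ioc, ENNReal.toReal_ofReal (by
    rw [pow_succ]; linarith), smul_eq_mul] at h4
  refine le_trans (le_of_eq ?_) (mul_le_mul_of_nonneg_left h4 (by positivity))
  rw [pow_succ, Real.mul_rpow hj.le two_pos.le]
  field_simp
  ring

/-- An abstract Keller-Osserman iteration. -/
lemma eventually_energy_lt {n k m : ℕ} (hk : 1 ≤ k) (hm : 1 ≤ m) {p ω C κ ρ : ℝ}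
    (hω : 0 < ω) (hC : 0 < C) (hκ : 0 < κ) {f : ℝ → ℝ}
    (hpos : ∀ ζ, 0 < ζ → 0 < f ζ) {E : ℝ → ℝ → ℝ}
    (hE : ∀ r R t T, r ≤ R → t ≤ T → E r t ≤ E R T)
    (hkey : ∀ r R t T b, ρ ≤ r → r < R → 0 < t → t < T → 0 ≤ b → E R T < ω * (R ^ n * T) * f b →
      E r t ≤ C * (ω * (R ^ n * T) * (b / (T - t) ^ k + b ^ p / (R - r) ^ m)))
    {X Y : ℕ → ℝ} (hX0 : ∀ j, 0 < X j) (hY0 : ∀ j, 0 < Y j) (hX : Summable X) (hY : Summable Y)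
    (hXf : ∀ j, X j ^ k * f (2 ^ j) = 2 ^ j) (hYf : ∀ j, Y j ^ m * f (2 ^ j) = (2 ^ j) ^ p)
    {ε : ℝ} (hε : 0 < ε) : ∀ᶠ R in atTop, E R (R ^ κ) < ε * (R ^ n * R ^ κ) := by
  have hf1 := hpos 1 one_pos
  set K := min ω (ε / f 1) with hK
  have hK0 : 0 < K := lt_min hω (div_pos hε hf1)
  set B := C * ω * 2 ^ (n + 1) * (2 + 2 ^ p) / K + 1 with hB
  have hB1 : 1 ≤ B := by rw [hB]; linarith [show 0 ≤ C * ω * 2 ^ (n + 1) * (2 + 2 ^ p) / K by positivity]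
  have hBK : C * ω * 2 ^ (n + 1) * (2 + 2 ^ p) < K * B := by
    rw [hB, mul_add_one, mul_div_cancel₀ _ hK0.ne']; linarith
  have hlim : Tendsto (fun R : ℝ => B * ((∑' j, X j) / R ^ κ + (∑' j, Y j) / R)) atTop (nhds 0) := by
    have h1 : Tendsto (fun R : ℝ => (∑' j, X j) / R ^ κ) atTop (nhds 0) :=
      (tendsto_rpow_atTop hκ).const_div_atTop _
    have h2 : Tendsto (fun R : ℝ => (∑' j, Y j) / R) atTop (nhds 0) :=
      tendsto_id.const_div_atTop _
    simpa using (h1.add h2).const_mul B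
  filter_upwards [hlim.eventually_le_const one_pos, eventually_ge_atTop ρ, eventually_gt_atTop 0]
    with R hR1 hRρ hR0
  by_contra! hcon
  have hRκ : 0 < R ^ κ := Real.rpow_pos_of_pos hR0 κ
  set θ : ℕ → ℝ := fun j => B * (X j / R ^ κ + Y j / R) with hθ
  have hB0 : 0 < B := one_pos.trans_le hB1
  have hθ0 : ∀ j, 0 < θ j := fun j => by
    have := hX0 j; have := hY0 j; positivity
  set s : ℕ → ℝ := fun j => ∑ i ∈ Finset.range j, θ i with hs
  have hs0 : ∀ j, 0 ≤ s j := fun j => Finset.sum_nonneg fun i _ => (hθ0 i).le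
  have hθs : HasSum θ (B * ((∑' j, X j) / R ^ κ + (∑' j, Y j) / R)) :=
    ((hX.hasSum.div_const _).add (hY.hasSum.div_const _)).mul_left B
  have hs1 : ∀ j, s j ≤ 1 := fun j =>
    (sum_le_hasSum _ (fun i _ => (hθ0 i).le) hθs).trans hR1
  have hsucc : ∀ j, s (j + 1) = s j + θ j := fun j => Finset.sum_range_succ _ _
  have hind : ∀ j, K * f (2 ^ j) * (R ^ n * R ^ κ) ≤ E (R * (1 + s j)) (R ^ κ * (1 + s j)) := by
    intro j
    induction j with
    | zero =>
      simp only [hs, Finset.range_zero, Finset.sum_empty, add_zero, mul_one, pow_zero]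
      refine le_trans ?_ hcon
      gcongr
      rw [← le_div_iff₀ hf1]
      exact min_le_right _ _
    | succ j ih =>
      by_contra! hlt
      have hfj := hpos (2 ^ j) (by positivity)
      have hfj1 := hpos (2 ^ (j + 1)) (by positivity)
      have h0 := hs0 j
      have h1 := hs0 (j + 1)
      have h2 := hs1 (j + 1)
      have hθj := hθ0 j
      have hvol1 : R ^ n * R ^ κ ≤ (R * (1 + s (j + 1))) ^ n * (R ^ κ * (1 + s (j + 1))) := by
        have h3 : R ≤ R * (1 + s (j + 1)) := le_mul_of_one_le_right hR0.le (by linarith)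
        have h4 : R ^ κ ≤ R ^ κ * (1 + s (j + 1)) := le_mul_of_one_le_right hRκ.le (by linarith)
        gcongr
      have hvol2 : (R * (1 + s (j + 1))) ^ n * (R ^ κ * (1 + s (j + 1)))
          ≤ 2 ^ (n + 1) * (R ^ n * R ^ κ) := by
        have h3 : R * (1 + s (j + 1)) ≤ R * 2 := by gcongr; linarith
        have h4 : R ^ κ * (1 + s (j + 1)) ≤ R ^ κ * 2 := by gcongr; linarith
        calc (R * (1 + s (j + 1))) ^ n * (R ^ κ * (1 + s (j + 1))) ≤ (R * 2) ^ n * (R ^ κ * 2) := by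
              gcongr
          _ = _ := by rw [mul_pow, pow_succ]; ring
      have hk1 := hkey (R * (1 + s j)) (R * (1 + s (j + 1))) (R ^ κ * (1 + s j))
        (R ^ κ * (1 + s (j + 1))) (2 ^ (j + 1))
        (hRρ.trans (le_mul_of_one_le_right hR0.le (by linarith)))
        (by rw [hsucc]; gcongr; linarith) (by positivity) (by rw [hsucc]; gcongr; linarith)
        (by positivity) (hlt.trans_le (by
          calc K * f (2 ^ (j + 1)) * (R ^ n * R ^ κ) = K * (R ^ n * R ^ κ) * f (2 ^ (j + 1)) := by ring
            _ ≤ _ := by gcongr; exact min_le_left _ _))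
      have hXj := hX0 j
      have hYj := hY0 j
      have hd1 : B * X j ≤ R ^ κ * (1 + s (j + 1)) - R ^ κ * (1 + s j) := by
        have : R ^ κ * (1 + s (j + 1)) - R ^ κ * (1 + s j) = B * X j + R ^ κ * B * Y j / R := by
          rw [hsucc]; simp only [hθ]; field_simp; ring
        rw [this]
        linarith [show 0 ≤ R ^ κ * B * Y j / R by positivity]
      have hd2 : B * Y j ≤ R * (1 + s (j + 1)) - R * (1 + s j) := by
        have : R * (1 + s (j + 1)) - R * (1 + s j) = B * Y j + R * B * X j / R ^ κ := by
          rw [hsucc]; simp only [hθ]; field_simp; ring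
        rw [this]
        linarith [show 0 ≤ R * B * X j / R ^ κ by positivity]
      have he1 : (2 : ℝ) ^ (j + 1) / (R ^ κ * (1 + s (j + 1)) - R ^ κ * (1 + s j)) ^ k
          ≤ 2 * f (2 ^ j) / B := by
        calc (2 : ℝ) ^ (j + 1) / (R ^ κ * (1 + s (j + 1)) - R ^ κ * (1 + s j)) ^ k
            ≤ 2 ^ (j + 1) / (B * X j) ^ k := by gcongr
          _ = 2 * f (2 ^ j) / B ^ k := by
              rw [pow_succ, mul_pow, div_eq_div_iff (by positivity) (by positivity)]
              linear_combination (-2 * B ^ k) * hXf j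
          _ ≤ _ := by gcongr; exact le_self_pow₀ hB1 (by omega)
      have he2 : ((2 : ℝ) ^ (j + 1)) ^ p / (R * (1 + s (j + 1)) - R * (1 + s j)) ^ m
          ≤ 2 ^ p * f (2 ^ j) / B := by
        calc ((2 : ℝ) ^ (j + 1)) ^ p / (R * (1 + s (j + 1)) - R * (1 + s j)) ^ m
            ≤ (2 ^ (j + 1)) ^ p / (B * Y j) ^ m := by gcongr
          _ = 2 ^ p * f (2 ^ j) / B ^ m := by
              rw [pow_succ, Real.mul_rpow (by positivity) two_pos.le, ← hYf j, mul_pow]; field_simp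
          _ ≤ _ := by gcongr; exact le_self_pow₀ hB1 (by omega)
      have hfin := ih.trans (hk1.trans (mul_le_mul_of_nonneg_left (mul_le_mul
        (mul_le_mul_of_nonneg_left hvol2 hω.le) (add_le_add he1 he2) (add_nonneg (div_nonneg
          (by positivity) (pow_nonneg (by linarith [mul_pos hB0 hXj]) _)) (div_nonneg
          (by positivity) (pow_nonneg (by linarith [mul_pos hB0 hYj]) _))) (by positivity)) hC.le))
      have hP : 0 < f (2 ^ j) * (R ^ n * R ^ κ) := by positivity
      have h5 : K * B * (f (2 ^ j) * (R ^ n * R ^ κ)) ≤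
          C * ω * 2 ^ (n + 1) * (2 + 2 ^ p) * (f (2 ^ j) * (R ^ n * R ^ κ)) := by
        calc K * B * (f (2 ^ j) * (R ^ n * R ^ κ)) = B * (K * f (2 ^ j) * (R ^ n * R ^ κ)) := by ring
          _ ≤ B * _ := mul_le_mul_of_nonneg_left hfin hB0.le
          _ = _ := by field_simp
      exact absurd (le_of_mul_le_mul_right h5 hP) (not_le.2 hBK)
  have hcoef : 0 < K * (R ^ n * R ^ κ) := by positivity
  have hbig : Tendsto (fun j : ℕ => K * (R ^ n * R ^ κ) * 2 ^ j) atTop atTop :=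
    (tendsto_pow_atTop_atTop_of_one_lt one_lt_two).const_mul_atTop hcoef
  obtain ⟨j, hj1, hj2⟩ := ((hbig.eventually_gt_atTop (E (R * 2) (R ^ κ * 2))).and
    (hX.tendsto_atTop_zero.eventually_le_const one_pos)).exists
  have hfj := hpos (2 ^ j) (by positivity)
  have h2f : (2 : ℝ) ^ j ≤ f (2 ^ j) := by
    refine (hXf j).symm.le.trans ?_
    exact mul_le_of_le_one_left hfj.le (pow_le_one₀ (hX0 j).le hj2)
  have h6 : E (R * (1 + s j)) (R ^ κ * (1 + s j)) ≤ E (R * 2) (R ^ κ * 2) := by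
    have := hs1 j
    apply hE <;> gcongr <;> linarith
  have h7 : K * (R ^ n * R ^ κ) * 2 ^ j ≤ K * f (2 ^ j) * (R ^ n * R ^ κ) := by
    calc K * (R ^ n * R ^ κ) * 2 ^ j ≤ K * (R ^ n * R ^ κ) * f (2 ^ j) := by gcongr
      _ = _ := by ring
  linarith [hind j]

end KellerOsserman

section DyadicSum

lemma sub_mul_rpow_le {x y ε : ℝ} (hx : 0 < x) (hxy : x ≤ y) (hε : 0 < ε) :
    (y - x) * y ^ (-(1 + ε)) ≤ ε⁻¹ * (x ^ (-ε) - y ^ (-ε)) := by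
  have hy : 0 < y := hx.trans_le hxy
  have hz : 0 < x / y := div_pos hx hy
  have h1 : 1 + ε * (1 - x / y) ≤ (x / y) ^ (-ε) := by
    rw [Real.rpow_def_of_pos hz]
    have h2 := Real.log_le_sub_one_of_pos hz
    have h3 := Real.add_one_le_exp (Real.log (x / y) * -ε)
    nlinarith
  have h4 := mul_le_mul_of_nonneg_right h1 (Real.rpow_nonneg hy.le (-ε))
  rw [← Real.mul_rpow hz.le hy.le, div_mul_cancel₀ _ hy.ne'] at h4
  have h5 : y ^ (-(1 + ε)) = y ^ (-ε) / y := by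
    rw [neg_add', ← Real.rpow_sub_one hy.ne']; congr 1; ring
  rw [h5, inv_mul_eq_div, le_div_iff₀ hε]
  have h6 : (y - x) * (y ^ (-ε) / y) * ε = ε * (1 - x / y) * y ^ (-ε) := by
    field_simp
  rw [h6]
  linarith

lemma integrableOn_Icc_mul_rpow {f : ℝ → ℝ} (hm : MonotoneOn f (Ici 0)) {x y : ℝ} (hx : 0 < x)
    (q : ℝ) : IntegrableOn (fun r : ℝ => f r * r ^ q) (Icc x y) := by
  refine IntegrableOn.mul_continuousOn ?_ ?_ isCompact_Icc
  · exact (hm.mono fun r hr => hx.le.trans hr.1).integrableOn_isCompact isCompact_Icc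
  · exact fun r hr => (Real.continuousAt_rpow_const r q
      (Or.inl (hx.trans_le hr.1).ne')).continuousWithinAt

lemma integrableOn_of_dyadic_sequence {f : ℝ → ℝ} (hm : MonotoneOn f (Ici 0))
    (h0 : ∀ ζ, 0 ≤ ζ → 0 ≤ f ζ) {γ M c ε : ℝ} (hγ : 0 < γ) (hM : 0 ≤ M) (hc : 0 ≤ c) (hε : 0 < ε)
    {σ E : ℕ → ℝ} (hσ : ∀ i, 0 < σ i) (hE0 : ∀ i, 0 < E i) (hE : Monotone E)
    (hσc : ∀ i, σ i ≤ c * σ (i + 1))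
    (hstep : ∀ i, f (σ i) * σ (i + 1) ^ (-γ) ≤ M * ((E (i + 1) - E i) * E (i + 1) ^ (-(1 + ε))))
    (hinf : ∀ δ, 0 < δ → ∃ i, σ i < δ) :
    IntegrableOn (fun r : ℝ => f r * r ^ (-1 - γ)) (Ioo 0 1) := by
  have hcover : Ioo (0 : ℝ) 1 ⊆ (⋃ i, Ioc (σ (i + 1)) (σ i)) ∪ Icc (σ 0) 1 := by
    intro x hx
    rcases le_or_gt (σ 0) x with h | h
    · exact Or.inr ⟨h, hx.2.le⟩
    left
    classical
    have hex := hinf x hx.1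
    have hpos : Nat.find hex ≠ 0 := fun h' => by
      have := Nat.find_spec hex
      rw [h'] at this
      linarith
    obtain ⟨i, hi⟩ := Nat.exists_eq_succ_of_ne_zero hpos
    refine mem_iUnion.2 ⟨i, ?_, ?_⟩
    · have := Nat.find_spec hex
      rwa [hi] at this
    · exact not_lt.1 (Nat.find_min hex (hi ▸ Nat.lt_succ_self i))
  refine IntegrableOn.mono_set ?_ hcover
  refine IntegrableOn.union ?_ (integrableOn_Icc_mul_rpow hm (hσ 0) _)
  have hI : ∀ i, IntegrableOn (fun r : ℝ => f r * r ^ (-1 - γ)) (Ioc (σ (i + 1)) (σ i)) := fun i =>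
    (integrableOn_Icc_mul_rpow hm (hσ (i + 1)) _).mono_set Ioc_subset_Icc_self
  refine integrableOn_iUnion_of_summable_integral_norm hI ?_
  have hbound : ∀ i, ∫ r in Ioc (σ (i + 1)) (σ i), ‖f r * r ^ (-1 - γ)‖ ≤
      c * M * ε⁻¹ * (E i ^ (-ε) - E (i + 1) ^ (-ε)) := by
    intro i
    have hEi := sub_mul_rpow_le (hE0 i) (hE i.le_succ) hε
    have hdiff : 0 ≤ ε⁻¹ * (E i ^ (-ε) - E (i + 1) ^ (-ε)) :=
      (mul_nonneg (sub_nonneg.2 (hE i.le_succ)) (Real.rpow_nonneg (hE0 _).le _)).trans hEi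
    have hrhs : 0 ≤ c * M * ε⁻¹ * (E i ^ (-ε) - E (i + 1) ^ (-ε)) := by
      rw [mul_assoc]; positivity
    rcases le_or_gt (σ i) (σ (i + 1)) with h | h
    · rwa [Ioc_eq_empty (not_lt.2 h), Measure.restrict_empty, integral_zero_measure]
    have hs := hσ (i + 1)
    have hpt : ∀ r ∈ Ioc (σ (i + 1)) (σ i), ‖f r * r ^ (-1 - γ)‖ ≤
        f (σ i) * σ (i + 1) ^ (-1 - γ) := fun r hr => by
      have hr0 := hs.trans hr.1
      have hfr := h0 r hr0.le
      rw [Real.norm_of_nonneg (by positivity)]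
      have h1 := hm hr0.le (hσ i).le hr.2
      have h2 := Real.rpow_le_rpow_of_nonpos hs hr.1.le (by linarith : -1 - γ ≤ 0)
      have h3 := h0 _ (hσ i).le
      gcongr
    have h1 := setIntegral_mono_on (hI i).norm (integrableOn_const (by simp)) measurableSet_Ioc hpt
    rw [setIntegral_const, measureReal_def, Real.volume_Ioc, ENNReal.toReal_ofReal (by linarith),
      smul_eq_mul] at h1
    have h2 := h0 _ (hσ i).le
    calc ∫ r in Ioc (σ (i + 1)) (σ i), ‖f r * r ^ (-1 - γ)‖
        ≤ (σ i - σ (i + 1)) * (f (σ i) * σ (i + 1) ^ (-1 - γ)) := h1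
      _ ≤ (c * σ (i + 1)) * (f (σ i) * σ (i + 1) ^ (-1 - γ)) := by
          gcongr; linarith [hσc i]
      _ = c * (f (σ i) * σ (i + 1) ^ (-γ)) := by
          rw [show -1 - γ = -γ - 1 by ring, Real.rpow_sub_one hs.ne']; field_simp
      _ ≤ c * (M * (ε⁻¹ * (E i ^ (-ε) - E (i + 1) ^ (-ε)))) := by
          exact mul_le_mul_of_nonneg_left ((hstep i).trans (mul_le_mul_of_nonneg_left hEi hM)) hc
      _ = _ := by ring
  refine summable_of_sum_range_le (c := c * M * ε⁻¹ * E 0 ^ (-ε))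
    (fun i => integral_nonneg fun _ => norm_nonneg _) fun N => ?_
  calc ∑ i ∈ Finset.range N, ∫ r in Ioc (σ (i + 1)) (σ i), ‖f r * r ^ (-1 - γ)‖
      ≤ ∑ i ∈ Finset.range N, c * M * ε⁻¹ * (E i ^ (-ε) - E (i + 1) ^ (-ε)) :=
        Finset.sum_le_sum fun i _ => hbound i
    _ = c * M * ε⁻¹ * (E 0 ^ (-ε) - E N ^ (-ε)) := by
        rw [← Finset.mul_sum, Finset.sum_range_sub']
    _ ≤ _ := by
        have := Real.rpow_nonneg (hE0 N).le (-ε)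
        gcongr
        linarith

end DyadicSum

section DyadicGrowth

/-- Dyadic growth of the energy `F`: if each layer `[R, 2R]` either carries much energy or bounds
the energy inside, and `F` is `o(R ^ N)`, then `f r * r ^ (-1 - γ)` is integrable near zero. -/
lemma integrableOn_of_layer_growth {f F : ℝ → ℝ} (hfm : MonotoneOn f (Ici 0))
    (h0 : 0 ≤ f 0) (hpos : ∀ ζ, 0 < ζ → 0 < f ζ) {k m : ℕ} {p τ γ κ N v C a R₀ : ℝ} (hp : 0 < p)
    (hγ : 1 < γ) (hγp : p < γ) (hN : N = τ * γ) (hκ : κ * k = τ * (γ - 1))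
    (hmτ : (m : ℝ) = τ * (γ - p)) (hv : 0 < v) (hC : 0 < C) (ha : 0 < a) (hR₀ : 1 ≤ R₀)
    (hF0 : 0 < F R₀) (hF : ∀ r R, 0 < r → r ≤ R → F r ≤ F R)
    (hlayer : ∀ R b, R₀ ≤ R → 0 ≤ b → F (2 * R) - F R < v * R ^ N * f b →
      F R ≤ C * (R ^ N * (b / (a * (R ^ κ) ^ k) + b ^ p / R ^ m)))
    (hsmall : ∀ ε, 0 < ε → ∀ᶠ R in atTop, F R < ε * R ^ N) :
    IntegrableOn (fun r : ℝ => f r * r ^ (-1 - γ)) (Ioo 0 1) := by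
  have hR₀0 : 0 < R₀ := one_pos.trans_le hR₀
  set q := max 1 p with hq
  have hq0 : 0 < q := one_pos.trans_le (le_max_left _ _)
  have hq1 : q⁻¹ - 1 ≤ 0 := by
    linarith [inv_le_one_of_one_le₀ (le_max_left 1 p)]
  have hqp : p * q⁻¹ - 1 ≤ 0 := by
    rw [sub_nonpos, ← div_eq_mul_inv, div_le_one hq0]; exact le_max_right _ _
  obtain ⟨c, hc1, hc⟩ : ∃ c, C * (c / a * F R₀ ^ (q⁻¹ - 1) + c ^ p * F R₀ ^ (p * q⁻¹ - 1)) < 1 ∧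
      0 < c := by
    have hcont : Continuous fun c : ℝ =>
        C * (c / a * F R₀ ^ (q⁻¹ - 1) + c ^ p * F R₀ ^ (p * q⁻¹ - 1)) := by
      have := Real.continuous_rpow_const hp.le
      fun_prop
    have hlim := hcont.tendsto 0
    simp only [zero_div, zero_mul, Real.zero_rpow hp.ne', add_zero, mul_zero] at hlim
    exact (((hlim.mono_left (nhdsWithin_le_nhds (s := Ioi 0))).eventually_lt_const
      one_pos).and self_mem_nhdsWithin).exists
  set R : ℕ → ℝ := fun i => 2 ^ i * R₀ with hR
  have hRR₀ : ∀ i, R₀ ≤ R i := fun i => le_mul_of_one_le_left hR₀0.le (one_le_pow₀ one_le_two)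
  have hRpos : ∀ i, 0 < R i := fun i => hR₀0.trans_le (hRR₀ i)
  have hRsucc : ∀ i, R (i + 1) = 2 * R i := fun i => by simp only [hR]; ring
  have hEmono : Monotone fun i => F (R i) := monotone_nat_of_le_succ fun i =>
    hF _ _ (hRpos i) (by rw [hRsucc]; linarith [hRpos i])
  have hE₀ : ∀ i, F R₀ ≤ F (R i) := fun i => hF _ _ hR₀0 (hRR₀ i)
  have hEpos : ∀ i, 0 < F (R i) := fun i => hF0.trans_le (hE₀ i)
  set σ : ℕ → ℝ := fun i => c * R i ^ (-τ) * F (R i) ^ q⁻¹ with hσ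
  have hσpos : ∀ i, 0 < σ i := fun i => by
    have := hRpos i; have := hEpos i; positivity
  have hinc : ∀ i, v * R i ^ N * f (σ i) ≤ F (R (i + 1)) - F (R i) := by
    intro i
    by_contra! hlt
    rw [hRsucc] at hlt
    have hr := hRpos i
    have he := hEpos i
    have h1 := hlayer (R i) (σ i) (hRR₀ i) (hσpos i).le hlt
    have h2 : R i ^ N * (σ i / (a * (R i ^ κ) ^ k)) = c / a * F (R i) ^ q⁻¹ := by
      have : (R i ^ κ) ^ k = R i ^ N * R i ^ (-τ) := by
        rw [← Real.rpow_natCast, ← Real.rpow_mul hr.le, hκ, ← Real.rpow_add hr, hN]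
        congr 1; ring
      rw [this]
      simp only [hσ]
      have := (Real.rpow_pos_of_pos hr N).ne'
      have := (Real.rpow_pos_of_pos hr (-τ)).ne'
      field_simp
    have h3 : R i ^ N * (σ i ^ p / R i ^ m) = c ^ p * F (R i) ^ (p * q⁻¹) := by
      have h4 : σ i ^ p = c ^ p * R i ^ (-τ * p) * F (R i) ^ (p * q⁻¹) := by
        simp only [hσ]
        rw [Real.mul_rpow (by positivity) (by positivity), Real.mul_rpow hc.le (by positivity),
          ← Real.rpow_mul hr.le, ← Real.rpow_mul he.le, mul_comm q⁻¹ p]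
      have h5 : R i ^ m = R i ^ N * R i ^ (-τ * p) := by
        rw [← Real.rpow_natCast, hmτ, ← Real.rpow_add hr, hN]
        congr 1; ring
      rw [h4, h5]
      have := (Real.rpow_pos_of_pos hr N).ne'
      have := (Real.rpow_pos_of_pos hr (-τ * p)).ne'
      field_simp
    rw [mul_add, h2, h3] at h1
    have h6 : F (R i) ^ q⁻¹ ≤ F R₀ ^ (q⁻¹ - 1) * F (R i) := by
      have := Real.rpow_le_rpow_of_nonpos hF0 (hE₀ i) hq1
      calc F (R i) ^ q⁻¹ = F (R i) ^ (q⁻¹ - 1) * F (R i) := by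
            rw [Real.rpow_sub_one he.ne', div_mul_cancel₀ _ he.ne']
        _ ≤ _ := by gcongr
    have h7 : F (R i) ^ (p * q⁻¹) ≤ F R₀ ^ (p * q⁻¹ - 1) * F (R i) := by
      have := Real.rpow_le_rpow_of_nonpos hF0 (hE₀ i) hqp
      calc F (R i) ^ (p * q⁻¹) = F (R i) ^ (p * q⁻¹ - 1) * F (R i) := by
            rw [Real.rpow_sub_one he.ne', div_mul_cancel₀ _ he.ne']
        _ ≤ _ := by gcongr
    have h8 : F (R i) ≤
        C * (c / a * F R₀ ^ (q⁻¹ - 1) + c ^ p * F R₀ ^ (p * q⁻¹ - 1)) * F (R i) :=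
      calc F (R i) ≤ C * (c / a * F (R i) ^ q⁻¹ + c ^ p * F (R i) ^ (p * q⁻¹)) := h1
        _ ≤ C * (c / a * (F R₀ ^ (q⁻¹ - 1) * F (R i))
            + c ^ p * (F R₀ ^ (p * q⁻¹ - 1) * F (R i))) := by gcongr
        _ = _ := by ring
    nlinarith
  have hRN : ∀ i, R (i + 1) ^ N = 2 ^ N * R i ^ N := fun i => by
    rw [hRsucc, Real.mul_rpow two_pos.le (hRpos i).le]
  refine integrableOn_of_dyadic_sequence (σ := σ) (E := fun i => F (R i)) (c := 2 ^ τ)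
    (M := c ^ (-γ) * 2 ^ N / v) (ε := γ * q⁻¹ - 1) hfm
    (fun ζ hζ => ?_) (by linarith) (by positivity) (by positivity) ?_ hσpos hEpos hEmono
    (fun i => ?_) (fun i => ?_) (fun δ hδ => ?_)
  · rcases hζ.eq_or_lt with rfl | h
    · exact h0
    · exact (hpos ζ h).le
  · rw [sub_pos, ← div_eq_mul_inv, one_lt_div hq0]
    exact max_lt hγ hγp
  · have hr := hRpos i
    have he := hEpos i
    have h1 : 2 ^ τ * R (i + 1) ^ (-τ) = R i ^ (-τ) := by
      rw [hRsucc, Real.mul_rpow two_pos.le hr.le, ← mul_assoc, ← Real.rpow_add two_pos,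
        add_neg_cancel, Real.rpow_zero, one_mul]
    have h2 := hEmono i.le_succ
    simp only at h2
    calc σ i = c * (2 ^ τ * R (i + 1) ^ (-τ)) * F (R i) ^ q⁻¹ := by rw [h1]
      _ ≤ c * (2 ^ τ * R (i + 1) ^ (-τ)) * F (R (i + 1)) ^ q⁻¹ := by
          have := hRpos (i + 1)
          gcongr
      _ = _ := by simp only [hσ]; ring
  · have hr := hRpos (i + 1)
    have he := hEpos (i + 1)
    have h1 : σ (i + 1) ^ (-γ) =
        c ^ (-γ) * (2 ^ N * R i ^ N) * F (R (i + 1)) ^ (-(1 + (γ * q⁻¹ - 1))) := by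
      simp only [hσ]
      rw [Real.mul_rpow (by positivity) (by positivity), Real.mul_rpow hc.le (by positivity),
        ← Real.rpow_mul hr.le, ← Real.rpow_mul he.le, ← hRN, hN]
      congr 2
      · congr 1; ring
      · ring
    rw [h1]
    have h2 := Real.rpow_nonneg he.le (-(1 + (γ * q⁻¹ - 1)))
    calc f (σ i) * (c ^ (-γ) * (2 ^ N * R i ^ N) * F (R (i + 1)) ^ (-(1 + (γ * q⁻¹ - 1))))
        = c ^ (-γ) * 2 ^ N / v *
          ((v * R i ^ N * f (σ i)) * F (R (i + 1)) ^ (-(1 + (γ * q⁻¹ - 1)))) := by field_simp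
      _ ≤ _ := by gcongr; exact hinc i
  · by_contra! hge
    have hfδ := hpos δ hδ
    have hlim : Tendsto (fun i => R (i + 1)) atTop atTop :=
      ((tendsto_pow_atTop_atTop_of_one_lt one_lt_two).atTop_mul_const hR₀0).comp
        (tendsto_add_atTop_nat 1)
    obtain ⟨i, hi⟩ := (hlim.eventually (hsmall (v * f δ / 2 ^ N) (by positivity))).exists
    have h1 := hinc i
    have hr := hRpos i
    have h2 : v * R i ^ N * f δ ≤ v * R i ^ N * f (σ i) := by
      have := hfm hδ.le (hσpos i).le (hge i)
      gcongr
    rw [hRN] at hi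
    have h3 : v * f δ / 2 ^ N * (2 ^ N * R i ^ N) = v * R i ^ N * f δ := by field_simp
    linarith [hEpos i]

end DyadicGrowth

/-- **Remark 3.1 (for Theorem 2.1).** The conclusion of Theorem 2.1 remains valid if,
instead of `u_{k-1} ≥ 0` a.e., one only requires that `U(r) = ∫_{B_r} u_{k-1} dx` is
nonnegative and nondecreasing on a neighborhood `[ρ, ∞)` of infinity. -/
theorem blowup_supercritical_dimension_weakened_initial_condition
    (n k m : ℕ) (hn : 1 ≤ n) (hk : 1 ≤ k) (hm : 1 ≤ m)
    (A p : ℝ) (hA : 0 < A) (hp : 0 < p)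
    (a : (Fin n → ℕ) → Spc n × ℝ → ℝ → ℝ) (ha : GoodCoeffs n m A p a)
    (f : ℝ → ℝ) (hf : GoodF p f)
    (u0 : ℕ → Spc n → ℝ) (hu0 : ∀ i < k, L1locInit n (u0 i))
    (ρ : ℝ) (hρ : 0 < ρ)
    (hUnn : ∀ r ∈ Ici ρ, 0 ≤ ∫ x in ball0 n r, u0 (k - 1) x)
    (hUmono : MonotoneOn (fun r : ℝ => ∫ x in ball0 n r, u0 (k - 1) x) (Ici ρ))
    (h14 : Cond14 k f) (h15 : Cond15 m p f)
    (hdim : (m : ℝ) * (1 - 1 / (k : ℝ)) < n)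
    (hp' : 1 - (m : ℝ) / (n : ℝ) < p)
    (γ : ℝ) (hγ : γ = ((n : ℝ) * p + (m : ℝ) / (k : ℝ)) / ((n : ℝ) - (1 - 1 / (k : ℝ)) * (m : ℝ)))
    (hdiv : ¬ IntegrableOn (fun r : ℝ => f r * r ^ (-1 - γ)) (Ioo 0 1))
    (u : Spc n × ℝ → ℝ) (hu : IsGlobalWeakSol n k m p a f u0 u) :
    TrivialSol n u := by

  by_contra hnt
  have hpos := hf.2.2.2.2
  have hn0 : (0 : ℝ) < n := by exact_mod_cast hn
  have hk0 : (0 : ℝ) < k := by exact_mod_cast hk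
  have hm0 : (0 : ℝ) < m := by exact_mod_cast hm
  have hd : 0 < (n : ℝ) - (1 - 1 / (k : ℝ)) * m := by linarith
  have hγd : γ * ((n : ℝ) - (1 - 1 / (k : ℝ)) * m) = n * p + m / k := by
    rw [hγ, div_mul_cancel₀ _ hd.ne']
  have hnp : (n : ℝ) - m < n * p := by
    have h1 := mul_lt_mul_of_pos_left hp' hn0
    rwa [mul_sub, mul_one, mul_div_cancel₀ _ hn0.ne'] at h1
  have hγ1 : 1 < γ := by
    rw [hγ, one_lt_div hd]
    have : (1 - 1 / (k : ℝ)) * m = m - m / k := by ring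
    linarith
  have hk1 : 1 / (k : ℝ) ≤ 1 := (div_le_one hk0).2 (by exact_mod_cast hk)
  have hγp : p < γ := by
    rw [hγ, lt_div_iff₀ hd]
    have h1 : 0 ≤ p * ((1 - 1 / (k : ℝ)) * m) := by
      have := sub_nonneg.2 hk1
      positivity
    have h2 : 0 < (m : ℝ) / k := by positivity
    linarith
  set τ : ℝ := m / (γ - p) with hτ
  have hγp' : 0 < γ - p := sub_pos.2 hγp
  have hτ0 : 0 < τ := div_pos hm0 hγp'
  have hmτ : (m : ℝ) = τ * (γ - p) := (div_mul_cancel₀ _ hγp'.ne').symm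
  set κ : ℝ := τ * (γ - 1) / k with hκ
  have hκ0 : 0 < κ := div_pos (mul_pos hτ0 (sub_pos.2 hγ1)) hk0
  have hκk : κ * k = τ * (γ - 1) := div_mul_cancel₀ _ hk0.ne'
  have hN : (n : ℝ) + κ = τ * γ := by
    rw [hκ, hτ]
    field_simp
    field_simp at hγd
    linear_combination hγd
  obtain ⟨C, hC, hkey⟩ := exists_energy_le_of_layer_lt hk hm hA hp ha hf hu0 hρ hUnn hu
  obtain ⟨R₀, hR₀ρ, hR₀1, hE₀⟩ := exists_energy_pos hf hu hnt ρ hκ0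
  have hω := volume_real_ball_one_pos n
  set ω := volume.real (ball0 n 1)
  have hRn : ∀ R : ℝ, 0 < R → R ^ ((n : ℝ) + κ) = R ^ n * R ^ κ := fun R hR => by
    rw [Real.rpow_add hR, Real.rpow_natCast]
  have h2κ : 0 < (2 : ℝ) ^ κ - 1 := sub_pos.2 (Real.one_lt_rpow one_lt_two hκ0)
  have h2N : 0 < (2 : ℝ) ^ ((n : ℝ) + κ) - 1 :=
    sub_pos.2 (Real.one_lt_rpow one_lt_two (by positivity))
  refine hdiv (integrableOn_of_layer_growth (F := fun R => ∫ z in box n R (R ^ κ), f |u z|)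
    (k := k) (m := m) (p := p) (τ := τ) (κ := κ) (N := n + κ)
    (v := ω * (2 ^ ((n : ℝ) + κ) - 1)) (C := C * (ω * (2 ^ ((n : ℝ) + κ) - 1)))
    (a := (2 ^ κ - 1) ^ k) hf.1 (hf.nonneg le_rfl) hpos hp hγ1 hγp hN hκk hmτ (by positivity)
    (by positivity) (by positivity) hR₀1 hE₀
    (fun r R hr hrR => energy_mono hf hu hrR (Real.rpow_le_rpow hr.le hrR hκ0.le)) ?_ ?_)
  · intro R b hR hb hlt
    have hR0 : 0 < R := one_pos.trans_le (hR₀1.trans hR)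
    have hRκ : 0 < R ^ κ := Real.rpow_pos_of_pos hR0 κ
    have h2R : (2 * R) ^ κ = 2 ^ κ * R ^ κ := Real.mul_rpow two_pos.le hR0.le
    have hRκlt : R ^ κ < (2 * R) ^ κ := by
      rw [h2R]; nlinarith
    have hsub : box n R (R ^ κ) ⊆ box n (2 * R) ((2 * R) ^ κ) := box_mono (by linarith) hRκlt.le
    have hvol : volume.real (box n (2 * R) ((2 * R) ^ κ) \ box n R (R ^ κ)) =
        ω * (2 ^ ((n : ℝ) + κ) - 1) * R ^ ((n : ℝ) + κ) := by
      rw [measureReal_sdiff hsub (measurableSet_box n R _) (volume_box_lt_top n _ _).ne,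
        volume_real_box hn (by positivity) (by positivity),
        volume_real_box hn (by positivity) (by positivity), ← hRn _ (by positivity), ← hRn _ hR0,
        Real.mul_rpow two_pos.le hR0.le]
      ring
    have h1 := hkey R (2 * R) (R ^ κ) ((2 * R) ^ κ) b (hR₀ρ.trans hR) (by linarith) hRκ hRκlt hb
      (box n (2 * R) ((2 * R) ^ κ) \ box n R (R ^ κ))
      ((measurableSet_box n _ _).diff (measurableSet_box n _ _)) Subset.rfl sdiff_subset (by
        rw [setIntegral_sdiff (measurableSet_box n R _) (integrableOn_box hu.2.2.1 _ _) hsub, hvol]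
        exact hlt)
    rw [hvol, h2R, show 2 ^ κ * R ^ κ - R ^ κ = (2 ^ κ - 1) * R ^ κ by ring, mul_pow,
      show 2 * R - R = R by ring] at h1
    refine h1.trans (le_of_eq ?_)
    ring
  · intro ε hε
    have hq : ∀ j : ℕ, 0 < f (2 ^ j) := fun j => hpos _ (by positivity)
    have hpow : ∀ (q : ℝ) (d : ℕ), 1 ≤ d → ∀ j : ℕ,
        (((2 : ℝ) ^ j) ^ (q / d) / f (2 ^ j) ^ (d : ℝ)⁻¹) ^ d * f (2 ^ j) = (2 ^ j) ^ q := by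
      intro q d hd j
      have hd0 : (d : ℝ) ≠ 0 := by exact_mod_cast (by omega : d ≠ 0)
      have h1 : (((2 : ℝ) ^ j) ^ (q / d)) ^ d = (2 ^ j) ^ q := by
        rw [← Real.rpow_mul_natCast (by positivity), div_mul_cancel₀ _ hd0]
      rw [div_pow, h1, Real.rpow_inv_natCast_pow (hq j).le (by omega), div_mul_cancel₀ _ (hq j).ne']
    have h14' : IntegrableOn (fun ζ : ℝ => ζ ^ (1 / (k : ℝ) - 1) / f ζ ^ ((k : ℝ)⁻¹)) (Ioi 1) := by
      simpa only [one_div, Cond14] using h14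
    have hKO := eventually_energy_lt (n := n) (p := p) (κ := κ) (ρ := ρ) hk hm hω hC hκ0 hpos
      (E := fun R T => ∫ z in box n R T, f |u z|) (fun r R t T h h' => energy_mono hf hu h h')
      (fun r R t T b hr hrR ht htT hb hlt => by
        have hv := volume_real_box hn ((hρ.le.trans hr).trans hrR.le) (ht.trans htT).le
        rw [← hv] at hlt ⊢
        exact hkey r R t T b hr hrR ht htT hb _ (measurableSet_box n _ _) sdiff_subset
          Subset.rfl hlt)
      (fun j => div_pos (by positivity) (Real.rpow_pos_of_pos (hq j) _))
      (fun j => div_pos (by positivity) (Real.rpow_pos_of_pos (hq j) _))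
      (summable_dyadic_of_integrableOn hf.1 hpos (by positivity) (by positivity) h14')
      (summable_dyadic_of_integrableOn hf.1 hpos (by positivity) (by positivity) h15)
      (fun j => by rw [hpow 1 k hk, Real.rpow_one]) (fun j => hpow p m hm j) hε
    filter_upwards [hKO, eventually_gt_atTop 0] with R hR hR0
    rwa [hRn R hR0]
end
end

section
/- Let m ≥ 1 be an integer, p > 0 a real number, and let f : [0,∞) → ℝ be such that ζ ↦ f(ζ) and ζ ↦ f(ζ^{1/p}) are nondecreasing and convex on [0,∞), with f(ζ) > 0 for all ζ > 0. If ∫_1^∞ ζ^{p/m−1} f(ζ)^{−1/m} dζ = ∞, then for every w_0 > 0 the Cauchy problem w^{(m)}(r) = f(w(r)^{1/p}), w(0) = w_0, w^{(i)}(0) = 0 for i = 1, …, m−1, has a solution w of class C^m defined on the whole interval [0, ∞); moreover, this solution satisfies w(r) > w(0) for all r ∈ (0, ∞). -/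
open MeasureTheory Real Set

open Filter Topology

/-- The primitive of `u` vanishing at `0`. -/
noncomputable def primitiveZero (u : ℝ → ℝ) (r : ℝ) : ℝ := ∫ s in (0 : ℝ)..r, u s

/-- The integral operator whose fixed points on `[0, ∞)` solve `w^{(m)} = G(w)`, `w(0) = w₀`,
`w^{(i)}(0) = 0` for `1 ≤ i < m`. Its argument is only evaluated on `[0, ∞)`. -/
noncomputable def picardMap (m : ℕ) (w₀ : ℝ) (G : ℝ → ℝ) (u : ℝ → ℝ) (r : ℝ) : ℝ :=
  w₀ + primitiveZero^[m] (fun s => G (u (max s 0))) r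

lemma primitiveZero_zero (u : ℝ → ℝ) : primitiveZero u 0 = 0 := by
  simp [primitiveZero]

lemma hasDerivAt_primitiveZero {u : ℝ → ℝ} (hu : Continuous u) (r : ℝ) :
    HasDerivAt (primitiveZero u) (u r) r :=
  intervalIntegral.integral_hasDerivAt_right (hu.intervalIntegrable _ _)
    (hu.stronglyMeasurableAtFilter _ _) hu.continuousAt

lemma deriv_primitiveZero {u : ℝ → ℝ} (hu : Continuous u) : deriv (primitiveZero u) = u :=
  funext fun r => (hasDerivAt_primitiveZero hu r).deriv

lemma continuous_primitiveZero {u : ℝ → ℝ} (hu : ∀ a b, IntervalIntegrable u volume a b) :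
    Continuous (primitiveZero u) :=
  intervalIntegral.continuous_primitive hu 0

lemma continuous_iterate_primitiveZero {u : ℝ → ℝ} (hu : Continuous u) (n : ℕ) :
    Continuous (primitiveZero^[n] u) := by
  induction n with
  | zero => exact hu
  | succ n ih =>
    rw [Function.iterate_succ_apply']
    exact continuous_primitiveZero fun a b => ih.intervalIntegrable a b

lemma contDiff_iterate_primitiveZero {u : ℝ → ℝ} (hu : Continuous u) (n : ℕ) :
    ContDiff ℝ n (primitiveZero^[n] u) := by
  induction n with
  | zero => exact contDiff_zero.2 hu
  | succ n ih =>
    rw [Function.iterate_succ_apply']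
    have hc := continuous_iterate_primitiveZero hu n
    push_cast
    refine contDiff_succ_iff_deriv.2
      ⟨fun r => (hasDerivAt_primitiveZero hc r).differentiableAt, by simp, ?_⟩
    rwa [deriv_primitiveZero hc]

lemma iteratedDeriv_iterate_primitiveZero {u : ℝ → ℝ} (hu : Continuous u) (i n : ℕ) :
    iteratedDeriv i (primitiveZero^[n + i] u) = primitiveZero^[n] u := by
  induction i with
  | zero => simp
  | succ i ih =>
    rw [iteratedDeriv_succ', ← add_assoc, Function.iterate_succ_apply',
      deriv_primitiveZero (continuous_iterate_primitiveZero hu _), ih]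

lemma iterate_primitiveZero_nonneg {u : ℝ → ℝ} (hu : ∀ r, 0 ≤ r → 0 ≤ u r) (n : ℕ) :
    ∀ r, 0 ≤ r → 0 ≤ primitiveZero^[n] u r := by
  induction n with
  | zero => exact hu
  | succ n ih =>
    intro r hr
    rw [Function.iterate_succ_apply']
    exact intervalIntegral.integral_nonneg hr fun s hs => ih s hs.1

lemma iterate_primitiveZero_pos {u : ℝ → ℝ} (hu : Continuous u) (hpos : ∀ r, 0 < r → 0 < u r)
    (n : ℕ) : ∀ r, 0 < r → 0 < primitiveZero^[n] u r := by
  induction n with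
  | zero => exact hpos
  | succ n ih =>
    intro r hr
    rw [Function.iterate_succ_apply']
    exact intervalIntegral.intervalIntegral_pos_of_pos_on
      ((continuous_iterate_primitiveZero hu n).intervalIntegrable _ _) (fun s hs => ih s hs.1) hr

lemma iterate_primitiveZero_mono {u v : ℝ → ℝ} (hu : Continuous u) (hv : Continuous v)
    (huv : ∀ r, 0 ≤ r → u r ≤ v r) (n : ℕ) :
    ∀ r, 0 ≤ r → primitiveZero^[n] u r ≤ primitiveZero^[n] v r := by
  induction n with
  | zero => exact huv
  | succ n ih =>
    intro r hr
    rw [Function.iterate_succ_apply', Function.iterate_succ_apply']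
    exact intervalIntegral.integral_mono_on hr
      ((continuous_iterate_primitiveZero hu n).intervalIntegrable _ _)
      ((continuous_iterate_primitiveZero hv n).intervalIntegrable _ _) fun s hs => ih s hs.1

lemma monotoneOn_iterate_primitiveZero {u : ℝ → ℝ} (hu : Continuous u)
    (hmono : MonotoneOn u (Ici 0)) (hpos : ∀ r, 0 ≤ r → 0 ≤ u r) (n : ℕ) :
    MonotoneOn (primitiveZero^[n] u) (Ici 0) := by
  cases n with
  | zero => exact hmono
  | succ n =>
    rw [Function.iterate_succ_apply']
    have hc := continuous_iterate_primitiveZero hu n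
    refine monotoneOn_of_deriv_nonneg (convex_Ici 0)
      (continuous_primitiveZero fun a b => hc.intervalIntegrable a b).continuousOn
      (fun r _ => (hasDerivAt_primitiveZero hc r).differentiableAt.differentiableWithinAt) ?_
    intro r hr
    rw [interior_Ici] at hr
    rw [deriv_primitiveZero hc]
    exact iterate_primitiveZero_nonneg hpos n r (le_of_lt hr)

lemma sq_primitiveZero_le {u : ℝ → ℝ} (hu : Continuous u) (hmono : MonotoneOn u (Ici 0))
    (hpos : ∀ r, 0 ≤ r → 0 ≤ u r) {R : ℝ} (hR : 0 ≤ R) :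
    primitiveZero u R ^ 2 ≤ 2 * u R * primitiveZero (primitiveZero u) R := by
  have hc : Continuous (primitiveZero u) :=
    continuous_primitiveZero fun a b => hu.intervalIntegrable a b
  have hd : ∀ r, HasDerivAt
      (fun r => 2 * u R * primitiveZero (primitiveZero u) r - primitiveZero u r ^ 2)
      (2 * primitiveZero u r * (u R - u r)) r := by
    intro r
    refine (((hasDerivAt_primitiveZero hc r).const_mul (2 * u R)).sub
      ((hasDerivAt_primitiveZero hu r).pow 2)).congr_deriv ?_
    push_cast
    ring
  have hm : MonotoneOn
      (fun r => 2 * u R * primitiveZero (primitiveZero u) r - primitiveZero u r ^ 2)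
      (Icc 0 R) := by
    refine monotoneOn_of_deriv_nonneg (convex_Icc 0 R)
      (fun r _ => (hd r).continuousAt.continuousWithinAt)
      (fun r _ => (hd r).differentiableAt.differentiableWithinAt) ?_
    intro r hr
    rw [interior_Icc] at hr
    rw [(hd r).deriv]
    have h1 : 0 ≤ primitiveZero u r := iterate_primitiveZero_nonneg hpos 1 r hr.1.le
    have h2 : u r ≤ u R := hmono hr.1.le hR hr.2.le
    exact mul_nonneg (by linarith) (by linarith)
  have := hm (left_mem_Icc.2 hR) (right_mem_Icc.2 hR) hR
  simp only [primitiveZero_zero] at this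
  linarith

/-- A one-sided Landau–Kolmogorov inequality for functions with nondecreasing top derivative and
vanishing initial data. -/
lemma exists_iterate_primitiveZero_pow_le (n : ℕ) :
    ∃ C : ℝ, 0 ≤ C ∧ ∀ u : ℝ → ℝ, Continuous u → MonotoneOn u (Ici 0) →
      (∀ r, 0 ≤ r → 0 ≤ u r) → ∀ r, 0 ≤ r →
      primitiveZero^[n] u r ^ (n + 1) ≤ C * primitiveZero^[n + 1] u r ^ n * u r := by
  induction n with
  | zero => exact ⟨1, zero_le_one, fun u _ _ _ r _ => by simp⟩
  | succ n ih =>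
    obtain ⟨C, hC, h⟩ := ih
    refine ⟨2 ^ (n + 1) * C, by positivity, fun u hu hm hp r hr => ?_⟩
    have h1 := h u hu hm hp r hr
    have h2 := sq_primitiveZero_le (continuous_iterate_primitiveZero hu n)
      (monotoneOn_iterate_primitiveZero hu hm hp n) (iterate_primitiveZero_nonneg hp n) hr
    rw [← Function.iterate_succ_apply' primitiveZero n u,
      ← Function.iterate_succ_apply' primitiveZero (n + 1) u] at h2
    have ha := iterate_primitiveZero_nonneg hp n r hr
    have hb := iterate_primitiveZero_nonneg hp (n + 1) r hr
    have hc := iterate_primitiveZero_nonneg hp (n + 1 + 1) r hr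
    have hu0 := hp r hr
    generalize primitiveZero^[n] u r = a at *
    generalize primitiveZero^[n + 1] u r = b at *
    generalize primitiveZero^[n + 1 + 1] u r = c at *
    rcases hb.eq_or_lt with rfl | hb
    · rw [zero_pow (by omega)]
      positivity
    · refine le_of_mul_le_mul_left ?_ (pow_pos hb n)
      calc b ^ n * b ^ (n + 1 + 1) = (b ^ 2) ^ (n + 1) := by ring
        _ ≤ (2 * a * c) ^ (n + 1) := by gcongr
        _ = 2 ^ (n + 1) * c ^ (n + 1) * a ^ (n + 1) := by ring
        _ ≤ 2 ^ (n + 1) * c ^ (n + 1) * (C * b ^ n * u r) := by gcongr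
        _ = b ^ n * (2 ^ (n + 1) * C * c ^ (n + 1) * u r) := by ring

lemma tendsto_iterate_primitiveZero {u : ℕ → ℝ → ℝ} {v : ℝ → ℝ} (hu : ∀ k, Continuous (u k))
    (hb : ∀ R, 0 ≤ R → ∃ B, ∀ k, ∀ r ∈ Icc 0 R, |u k r| ≤ B)
    (hlim : ∀ r, 0 ≤ r → Tendsto (fun k => u k r) atTop (𝓝 (v r))) (n : ℕ) :
    (∀ R, 0 ≤ R → ∃ B, ∀ k, ∀ r ∈ Icc 0 R, |primitiveZero^[n] (u k) r| ≤ B) ∧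
      ∀ r, 0 ≤ r →
        Tendsto (fun k => primitiveZero^[n] (u k) r) atTop (𝓝 (primitiveZero^[n] v r)) := by
  induction n with
  | zero => exact ⟨hb, hlim⟩
  | succ n ih =>
    obtain ⟨ihb, ihl⟩ := ih
    simp only [Function.iterate_succ_apply']
    constructor
    · intro R hR
      obtain ⟨B, hB⟩ := ihb R hR
      refine ⟨B * R, fun k r hr => ?_⟩
      have h0 : 0 ≤ B := (abs_nonneg _).trans (hB k r hr)
      have := intervalIntegral.norm_integral_le_of_norm_le_const (a := 0) (b := r) (C := B)
        (f := primitiveZero^[n] (u k)) fun s hs => by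
          rw [uIoc_of_le hr.1] at hs
          exact hB k s ⟨hs.1.le, hs.2.trans hr.2⟩
      rw [Real.norm_eq_abs, sub_zero, abs_of_nonneg hr.1] at this
      exact this.trans (mul_le_mul_of_nonneg_left hr.2 h0)
    · intro r hr
      obtain ⟨B, hB⟩ := ihb r hr
      refine intervalIntegral.tendsto_integral_filter_of_dominated_convergence (fun _ => B)
        (Eventually.of_forall fun k =>
          (continuous_iterate_primitiveZero (hu k) n).aestronglyMeasurable)
        (Eventually.of_forall fun k => Eventually.of_forall fun s hs => ?_)
        intervalIntegrable_const (Eventually.of_forall fun s hs => ?_)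
      · rw [uIoc_of_le hr] at hs
        exact hB k s ⟨hs.1.le, hs.2⟩
      · rw [uIoc_of_le hr] at hs
        exact ihl s hs.1.le

section picard

variable {m : ℕ} {w₀ : ℝ} {G : ℝ → ℝ}

lemma continuous_picardMap (hG : Continuous G) {u : ℝ → ℝ} (hu : Continuous u) :
    Continuous (picardMap m w₀ G u) :=
  continuous_const.add (continuous_iterate_primitiveZero (by fun_prop) m)

lemma picardMap_zero (hm : 1 ≤ m) (u : ℝ → ℝ) : picardMap m w₀ G u 0 = w₀ := by
  obtain ⟨n, rfl⟩ := Nat.exists_eq_add_of_le' hm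
  simp [picardMap, Function.iterate_succ_apply', primitiveZero_zero]

lemma continuous_iterate_picardMap (hG : Continuous G) (k : ℕ) :
    Continuous ((picardMap m w₀ G)^[k] fun _ => w₀) := by
  induction k with
  | zero => exact continuous_const
  | succ k ih =>
    rw [Function.iterate_succ_apply']
    exact continuous_picardMap hG ih

lemma le_picardMap (hpos : ∀ t, 0 < G t) (u : ℝ → ℝ) {r : ℝ} (hr : 0 ≤ r) :
    w₀ ≤ picardMap m w₀ G u r :=
  le_add_of_nonneg_right (iterate_primitiveZero_nonneg (fun _ _ => (hpos _).le) m r hr)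

lemma iterate_picardMap_le_succ (hG : Continuous G) (hmono : Monotone G) (hpos : ∀ t, 0 < G t)
    (k : ℕ) : ∀ r, 0 ≤ r → (picardMap m w₀ G)^[k] (fun _ => w₀) r ≤
      (picardMap m w₀ G)^[k + 1] (fun _ => w₀) r := by
  induction k with
  | zero => exact fun r hr => le_picardMap (m := m) hpos (fun _ => w₀) hr
  | succ k ih =>
    intro r hr
    have h1 := continuous_iterate_picardMap (m := m) (w₀ := w₀) hG k
    have h2 := continuous_iterate_picardMap (m := m) (w₀ := w₀) hG (k + 1)
    rw [Function.iterate_succ_apply' _ (k + 1)]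
    nth_rewrite 1 [Function.iterate_succ_apply']
    exact add_le_add_right (iterate_primitiveZero_mono (by fun_prop) (by fun_prop)
      (fun s hs => hmono (ih _ (le_max_right _ _))) m r hr) _

lemma monotoneOn_picardMap (hG : Continuous G) (hmono : Monotone G) (hpos : ∀ t, 0 < G t)
    {u : ℝ → ℝ} (hu : Continuous u) (hum : MonotoneOn u (Ici 0)) :
    MonotoneOn (picardMap m w₀ G u) (Ici 0) := by
  have := monotoneOn_iterate_primitiveZero (u := fun s => G (u (max s 0))) (by fun_prop)
    (fun s _ t _ hst => hmono (hum (mem_Ici.2 (le_max_right _ _)) (mem_Ici.2 (le_max_right _ _))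
      (max_le_max_right 0 hst))) (fun _ _ => (hpos _).le) m
  exact fun s hs t ht hst => add_le_add_right (this hs ht hst) _

lemma monotoneOn_iterate_picardMap (hG : Continuous G) (hmono : Monotone G)
    (hpos : ∀ t, 0 < G t) (k : ℕ) :
    MonotoneOn ((picardMap m w₀ G)^[k] fun _ => w₀) (Ici 0) := by
  induction k with
  | zero => exact monotoneOn_const
  | succ k ih =>
    rw [Function.iterate_succ_apply']
    exact monotoneOn_picardMap hG hmono hpos (continuous_iterate_picardMap hG k) ih

/-- The a priori bound: Picard iterates are bounded at each point, uniformly in the iterate. -/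
lemma exists_iterate_picardMap_le (hm : 1 ≤ m) (hw₀ : 0 < w₀) (hG : Continuous G)
    (hmono : Monotone G) (hpos : ∀ t, 0 < G t)
    (hdiv : ∀ M : ℝ, ∃ x, w₀ ≤ x ∧
      M < ∫ t in w₀..x, (max t w₀ ^ (m - 1) * G t) ^ (-(m : ℝ)⁻¹)) (R : ℝ) (hR : 0 ≤ R) :
    ∃ B, ∀ k, (picardMap m w₀ G)^[k] (fun _ => w₀) R ≤ B := by
  obtain ⟨n, rfl⟩ := Nat.exists_eq_add_of_le' hm
  obtain ⟨C, hC, hLK⟩ := exists_iterate_primitiveZero_pow_le n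
  simp only [Nat.add_sub_cancel] at hdiv
  set q : ℝ := ((n + 1 : ℕ) : ℝ)⁻¹ with hq
  have hq0 : 0 ≤ q := by positivity
  have hbase : ∀ t, 0 < max t w₀ ^ n * G t := fun t =>
    mul_pos (pow_pos (lt_max_of_lt_right hw₀) n) (hpos t)
  set ψ : ℝ → ℝ := fun t => (max t w₀ ^ n * G t) ^ (-q) with hψ
  have hψc : Continuous ψ :=
    Continuous.rpow_const (by fun_prop) fun t => Or.inl (hbase t).ne'
  have hψ0 : ∀ t, 0 ≤ ψ t := fun t => Real.rpow_nonneg (hbase t).le _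
  obtain ⟨N, hN, hNR⟩ := hdiv (C ^ q * R)
  refine ⟨N, fun k => ?_⟩
  cases k with
  | zero => exact hN
  | succ k =>
    by_contra! hlt
    have hle := iterate_picardMap_le_succ (m := n + 1) (w₀ := w₀) hG hmono hpos k
    have hukm := monotoneOn_iterate_picardMap (m := n + 1) (w₀ := w₀) hG hmono hpos k
    have huk := continuous_iterate_picardMap (m := n + 1) (w₀ := w₀) hG k
    rw [Function.iterate_succ_apply'] at hlt hle
    set u := (picardMap (n + 1) w₀ G)^[k] fun _ => w₀
    set h : ℝ → ℝ := fun s => G (u (max s 0)) with hh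
    have hhc : Continuous h := by fun_prop
    have hhm : MonotoneOn h (Ici 0) := fun s _ t _ hst =>
      hmono (hukm (mem_Ici.2 (le_max_right _ _)) (mem_Ici.2 (le_max_right _ _))
        (max_le_max_right 0 hst))
    have hh0 : ∀ r, 0 ≤ r → 0 ≤ h r := fun _ _ => (hpos _).le
    have hd : ∀ r, HasDerivAt (picardMap (n + 1) w₀ G u) (primitiveZero^[n] h r) r := by
      intro r
      have := (hasDerivAt_primitiveZero (continuous_iterate_primitiveZero hhc n) r).const_add w₀
      rwa [← Function.iterate_succ_apply' primitiveZero] at this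
    set w := picardMap (n + 1) w₀ G u with hw
    have hw_le : ∀ r, 0 ≤ r → w₀ ≤ w r := fun r hr => le_picardMap hpos u hr
    have hD : ∀ r, 0 ≤ r → ψ (w r) * primitiveZero^[n] h r ≤ C ^ q := by
      intro r hr
      have h1 := hLK h hhc hhm hh0 r hr
      have ha := iterate_primitiveZero_nonneg hh0 n r hr
      have hb := iterate_primitiveZero_nonneg hh0 (n + 1) r hr
      have h2 : primitiveZero^[n] h r ^ (n + 1) ≤ C * (max (w r) w₀ ^ n * G (w r)) := by
        refine h1.trans ?_
        rw [mul_assoc]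
        refine mul_le_mul_of_nonneg_left (mul_le_mul (pow_le_pow_left₀ hb ?_ n) ?_
          (hh0 r hr) (pow_nonneg (hw₀.le.trans (le_max_right _ _)) n)) hC
        · refine le_max_of_le_left ?_
          have : w r = w₀ + primitiveZero^[n + 1] h r := rfl
          linarith
        · rw [hh]
          simp only [max_eq_left hr]
          exact hmono (hle r hr)
      have h3 : primitiveZero^[n] h r ≤ C ^ q * (max (w r) w₀ ^ n * G (w r)) ^ q := by
        rw [← Real.mul_rpow hC (hbase _).le]
        calc primitiveZero^[n] h r = (primitiveZero^[n] h r ^ (n + 1)) ^ q :=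
              (Real.pow_rpow_inv_natCast ha (by omega)).symm
          _ ≤ _ := Real.rpow_le_rpow (pow_nonneg ha _) h2 hq0
      calc ψ (w r) * primitiveZero^[n] h r
          ≤ ψ (w r) * (C ^ q * (max (w r) w₀ ^ n * G (w r)) ^ q) :=
            mul_le_mul_of_nonneg_left h3 (hψ0 _)
        _ = C ^ q := by
          have := (Real.rpow_pos_of_pos (hbase (w r)) q).ne'
          simp only [hψ, Real.rpow_neg (hbase (w r)).le]
          field_simp
    have hΦ : ∀ x, HasDerivAt (fun x => ∫ t in w₀..x, ψ t) (ψ x) x := fun x =>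
      intervalIntegral.integral_hasDerivAt_right (hψc.intervalIntegrable _ _)
        (hψc.stronglyMeasurableAtFilter _ _) hψc.continuousAt
    have hcomp : ∀ r, HasDerivAt (fun r => C ^ q * r - ∫ t in w₀..w r, ψ t)
        (C ^ q - ψ (w r) * primitiveZero^[n] h r) r := by
      intro r
      exact (((hasDerivAt_id r).const_mul (C ^ q)).sub
        ((hΦ (w r)).comp r (hd r))).congr_deriv (by rw [mul_one])
    have hmon : MonotoneOn (fun r => C ^ q * r - ∫ t in w₀..w r, ψ t) (Ici 0) := by
      refine monotoneOn_of_deriv_nonneg (convex_Ici 0)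
        (fun r _ => (hcomp r).continuousAt.continuousWithinAt)
        (fun r _ => (hcomp r).differentiableAt.differentiableWithinAt) ?_
      intro r hr
      rw [interior_Ici] at hr
      rw [(hcomp r).deriv]
      linarith [hD r (le_of_lt hr)]
    have h4 := hmon self_mem_Ici hR hR
    have h0 : w 0 = w₀ := picardMap_zero hm u
    simp only [h0, intervalIntegral.integral_same, mul_zero, sub_zero] at h4
    have h5 : ∫ t in w₀..N, ψ t ≤ ∫ t in w₀..w R, ψ t :=
      intervalIntegral.integral_mono_interval le_rfl hN hlt.le
        (Eventually.of_forall hψ0) (hψc.intervalIntegrable _ _)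
    linarith

lemma exists_continuous_fixedPoint_picardMap (hm : 1 ≤ m) (hG : Continuous G)
    (hmono : Monotone G) (hpos : ∀ t, 0 < G t)
    (hbdd : ∀ R, 0 ≤ R → ∃ B, ∀ k, (picardMap m w₀ G)^[k] (fun _ => w₀) R ≤ B) :
    ∃ w : ℝ → ℝ, Continuous w ∧ picardMap m w₀ G w = w := by
  set a : ℕ → ℝ → ℝ := fun k => (picardMap m w₀ G)^[k] fun _ => w₀ with ha
  have hac : ∀ k, Continuous (a k) := continuous_iterate_picardMap hG
  have ham : ∀ k, MonotoneOn (a k) (Ici 0) := monotoneOn_iterate_picardMap hG hmono hpos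
  have hak : ∀ r, 0 ≤ r → Monotone fun k => a k r := fun r hr =>
    monotone_nat_of_le_succ fun k => iterate_picardMap_le_succ hG hmono hpos k r hr
  have hlim : ∀ r, 0 ≤ r → Tendsto (fun k => a k r) atTop (𝓝 (⨆ k, a k r)) := by
    intro r hr
    obtain ⟨B, hB⟩ := hbdd r hr
    exact tendsto_atTop_ciSup (hak r hr) ⟨B, by rintro _ ⟨k, rfl⟩; exact hB k⟩
  set v : ℝ → ℝ := fun r => ⨆ k, a k r with hv
  have hvm : MonotoneOn v (Ici 0) := fun s hs t ht hst =>
    le_of_tendsto_of_tendsto' (hlim s hs) (hlim t ht) fun k => ham k hs ht hst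
  have hfix : ∀ r, 0 ≤ r → picardMap m w₀ G v r = v r := by
    intro r hr
    refine tendsto_nhds_unique ?_ ((tendsto_add_atTop_iff_nat 1).2 (hlim r hr))
    have : ∀ k, a (k + 1) r = picardMap m w₀ G (a k) r := fun k => by
      simp only [ha, Function.iterate_succ_apply']
    simp only [this]
    refine Tendsto.const_add w₀ ((tendsto_iterate_primitiveZero
      (u := fun k s => G (a k (max s 0))) (fun k => ?_) ?_ ?_ m).2 r hr)
    · have := hac k
      fun_prop
    · intro R hR
      obtain ⟨B, hB⟩ := hbdd R hR
      refine ⟨G B, fun k s hs => ?_⟩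
      rw [abs_of_pos (hpos _), max_eq_left hs.1]
      exact hmono ((ham k hs.1 hR hs.2).trans (hB k))
    · intro s _
      exact (hG.tendsto _).comp (hlim _ (le_max_right _ _))
  have hint : Monotone fun s => G (v (max s 0)) := fun s t hst =>
    hmono (hvm (mem_Ici.2 (le_max_right _ _)) (mem_Ici.2 (le_max_right _ _))
      (max_le_max_right 0 hst))
  refine ⟨picardMap m w₀ G v, ?_, ?_⟩
  · obtain ⟨n, rfl⟩ := Nat.exists_eq_add_of_le' hm
    refine continuous_const.add ?_
    rw [Function.iterate_succ_apply]
    exact continuous_iterate_primitiveZero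
      (continuous_primitiveZero fun a b => hint.intervalIntegrable) n
  · have : (fun s => G (picardMap m w₀ G v (max s 0))) = fun s => G (v (max s 0)) :=
      funext fun s => by rw [hfix _ (le_max_right _ _)]
    funext r
    rw [picardMap, this, ← picardMap]

lemma contDiff_of_picardMap_eq (hG : Continuous G) {w : ℝ → ℝ} (hw : Continuous w)
    (hfix : picardMap m w₀ G w = w) : ContDiff ℝ m w := by
  rw [← hfix]
  exact contDiff_const.add (contDiff_iterate_primitiveZero (by fun_prop) m)

lemma iteratedDeriv_of_picardMap_eq (hG : Continuous G) {w : ℝ → ℝ} (hw : Continuous w)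
    (hfix : picardMap m w₀ G w = w) {i : ℕ} (hi : 1 ≤ i) (him : i ≤ m) :
    iteratedDeriv i w = primitiveZero^[m - i] fun s => G (w (max s 0)) := by
  obtain ⟨j, rfl⟩ := Nat.exists_eq_add_of_le' hi
  obtain ⟨n, rfl⟩ := Nat.exists_eq_add_of_le' him
  have hc : Continuous fun s => G (w (max s 0)) := by fun_prop
  have hd : deriv w = primitiveZero^[n + j] fun s => G (w (max s 0)) := by
    funext r
    have := (hasDerivAt_primitiveZero (continuous_iterate_primitiveZero hc (n + j)) r).const_add w₀
    rw [← Function.iterate_succ_apply' primitiveZero] at this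
    have hw' : HasDerivAt (picardMap (n + (j + 1)) w₀ G w)
      (primitiveZero^[n + j] (fun s => G (w (max s 0))) r) r := this
    rw [hfix] at hw'
    exact hw'.deriv
  rw [iteratedDeriv_succ', hd, iteratedDeriv_iterate_primitiveZero hc, Nat.add_sub_cancel]

end picard

lemma exists_lt_integral_of_not_integrableOn {ψ : ℝ → ℝ} (hψ : Continuous ψ)
    (hψ0 : ∀ t, 0 ≤ ψ t) {a : ℝ} (h : ¬ IntegrableOn ψ (Ioi a)) (M : ℝ) :
    ∃ x, a ≤ x ∧ M < ∫ t in a..x, ψ t := by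
  by_contra! hM
  refine h (integrableOn_Ioi_of_intervalIntegral_norm_bounded M a (b := id) (l := atTop)
    (fun x => (hψ.integrableOn_Icc).mono_set Ioc_subset_Icc_self) tendsto_id ?_)
  filter_upwards [eventually_ge_atTop a] with x hx
  simpa only [Real.norm_of_nonneg (hψ0 _), id] using hM x hx

/-- The substitution `t = ζ ^ p` in the divergence condition. -/
lemma not_integrableOn_of_comp_rpow {m : ℕ} (hm : 1 ≤ m) {p : ℝ} (hp : 0 < p) {f : ℝ → ℝ}
    (hf : ContinuousOn f (Ioi 0)) (hf_pos : ∀ ζ : ℝ, 0 < ζ → 0 < f ζ)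
    (hdiv : ¬ IntegrableOn (fun ζ : ℝ => ζ ^ (p / (m : ℝ) - 1) / f ζ ^ ((m : ℝ)⁻¹)) (Ioi 1))
    {w₀ : ℝ} (hw₀ : 0 < w₀)
    (hψ : Continuous fun t =>
      (max t w₀ ^ (m - 1) * f (max t w₀ ^ (1 / p))) ^ (-(m : ℝ)⁻¹)) :
    ¬ IntegrableOn (fun t => (max t w₀ ^ (m - 1) * f (max t w₀ ^ (1 / p))) ^ (-(m : ℝ)⁻¹))
      (Ioi w₀) := by
  intro hint
  apply hdiv
  have h0 : IntegrableOn
      (fun t => (max t w₀ ^ (m - 1) * f (max t w₀ ^ (1 / p))) ^ (-(m : ℝ)⁻¹)) (Ioi 0) := by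
    rw [← Ioc_union_Ioi_eq_Ioi hw₀.le]
    exact ((hψ.integrableOn_Icc).mono_set Ioc_subset_Icc_self).union hint
  have h1 := (integrableOn_Ioi_comp_rpow_iff' _ hp.ne').2 h0
  set X := max 1 (w₀ ^ (1 / p)) with hX
  have hX1 : 1 ≤ X := le_max_left _ _
  rw [← Ioc_union_Ioi_eq_Ioi hX1]
  refine IntegrableOn.union ?_ ?_
  · refine (ContinuousOn.integrableOn_Icc ?_).mono_set Ioc_subset_Icc_self
    have hpos : ∀ x ∈ Icc 1 X, 0 < x := fun x hx => lt_of_lt_of_le one_pos hx.1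
    refine ContinuousOn.div ?_ ?_ ?_
    · exact continuousOn_id.rpow_const fun x hx => Or.inl (hpos x hx).ne'
    · exact (hf.mono fun x hx => hpos x hx).rpow_const
        fun x hx => Or.inl (hf_pos x (hpos x hx)).ne'
    · exact fun x hx => (Real.rpow_pos_of_pos (hf_pos x (hpos x hx)) _).ne'
  · refine (h1.mono_set (Ioi_subset_Ioi (by linarith))).congr_fun ?_ measurableSet_Ioi
    intro x hx
    have hx1 : X < x := hx
    have hx0 : 0 < x := by linarith
    have hxw : w₀ ≤ x ^ p := by
      have : w₀ ^ (1 / p) ≤ x := (le_max_right _ _).trans hx1.le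
      calc w₀ = (w₀ ^ (1 / p)) ^ p := by
            rw [← Real.rpow_mul hw₀.le, one_div_mul_cancel hp.ne', Real.rpow_one]
        _ ≤ x ^ p := Real.rpow_le_rpow (Real.rpow_nonneg hw₀.le _) this hp.le
    have hfx := hf_pos x hx0
    have hm0 : (m : ℝ) ≠ 0 := by positivity
    simp only [smul_eq_mul]
    rw [max_eq_left hxw, ← Real.rpow_mul hx0.le, mul_one_div_cancel hp.ne', Real.rpow_one,
      Real.mul_rpow (by positivity) hfx.le, ← Real.rpow_natCast, ← Real.rpow_mul hx0.le,
      ← Real.rpow_mul hx0.le, Real.rpow_neg hfx.le, ← mul_assoc, ← Real.rpow_add hx0,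
      div_eq_mul_inv]
    congr 2
    rw [Nat.cast_sub hm]
    field_simp
    push_cast
    ring



/-- **Remark 2.1, second part (Kiguradze–Kvinikadze).** If
`∫_1^∞ ζ^{p/m - 1} f(ζ)^{-1/m} dζ = ∞`, then for every `w₀ > 0` the Cauchy problem
`w^{(m)}(r) = f(w(r)^{1/p})`, `w(0) = w₀`, `w^{(i)}(0) = 0` for `i = 1, …, m-1`, has a
`C^m` solution on the whole interval `[0, ∞)`, which moreover satisfies
`w(r) > w(0)` for all `r > 0`. -/
theorem global_solution_of_ode_when_condition_1_5_fails
    (m : ℕ) (hm : 1 ≤ m) (p : ℝ) (hp : 0 < p)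
    (f : ℝ → ℝ) (hf_mono : MonotoneOn f (Ici 0)) (hf_conv : ConvexOn ℝ (Ici 0) f)
    (hfp_mono : MonotoneOn (fun ζ => f (ζ ^ (1 / p))) (Ici 0))
    (hfp_conv : ConvexOn ℝ (Ici 0) (fun ζ => f (ζ ^ (1 / p))))
    (hf_pos : ∀ ζ : ℝ, 0 < ζ → 0 < f ζ)
    (hdiv : ¬ IntegrableOn (fun ζ : ℝ => ζ ^ (p / (m : ℝ) - 1) / f ζ ^ ((m : ℝ)⁻¹)) (Ioi 1))
    (w₀ : ℝ) (hw₀ : 0 < w₀) :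
    ∃ w : ℝ → ℝ, ContDiffOn ℝ m w (Ici 0) ∧ w 0 = w₀ ∧
      (∀ i : ℕ, 1 ≤ i → i < m → iteratedDerivWithin i w (Ici 0) 0 = 0) ∧
      (∀ r ∈ Ici (0 : ℝ), iteratedDerivWithin m w (Ici 0) r = f (w r ^ (1 / p))) ∧
      ∀ r : ℝ, 0 < r → w 0 < w r := by
  set G : ℝ → ℝ := fun t => f (max t w₀ ^ (1 / p)) with hGdef
  have hmax : ∀ t, 0 < max t w₀ := fun t => lt_max_of_lt_right hw₀
  have hfc : ContinuousOn f (Ioi 0) := by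
    simpa only [interior_Ici] using hf_conv.continuousOn_interior
  have hG : Continuous G := by
    refine hfc.comp_continuous ?_ fun t => Real.rpow_pos_of_pos (hmax t) _
    exact (continuous_id.max continuous_const).rpow_const fun t => Or.inl (hmax t).ne'
  have hGm : Monotone G := fun s t hst =>
    hfp_mono (hmax s).le (hmax t).le (max_le_max_right w₀ hst)
  have hGpos : ∀ t, 0 < G t := fun t => hf_pos _ (Real.rpow_pos_of_pos (hmax t) _)
  have hbase : ∀ t, 0 < max t w₀ ^ (m - 1) * G t := fun t =>
    mul_pos (pow_pos (hmax t) _) (hGpos t)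
  have hψ : Continuous fun t => (max t w₀ ^ (m - 1) * G t) ^ (-(m : ℝ)⁻¹) :=
    Continuous.rpow_const (by fun_prop) fun t => Or.inl (hbase t).ne'
  obtain ⟨w, hwc, hfix⟩ := exists_continuous_fixedPoint_picardMap hm hG hGm hGpos
    (exists_iterate_picardMap_le hm hw₀ hG hGm hGpos
      (exists_lt_integral_of_not_integrableOn hψ (fun t => Real.rpow_nonneg (hbase t).le _)
        (not_integrableOn_of_comp_rpow hm hp hfc hf_pos hdiv hw₀ hψ)))
  have hcd : ContDiff ℝ m w := contDiff_of_picardMap_eq hG hwc hfix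
  have hw0 : w 0 = w₀ := by rw [← hfix, picardMap_zero hm]
  have hwithin : ∀ i, 1 ≤ i → i ≤ m → ∀ r ∈ Ici (0 : ℝ), iteratedDerivWithin i w (Ici 0) r =
      primitiveZero^[m - i] (fun s => G (w (max s 0))) r := by
    intro i hi him r hr
    rw [iteratedDerivWithin_eq_iteratedDeriv (uniqueDiffOn_Ici 0)
      (hcd.of_le (by exact_mod_cast him)).contDiffAt hr,
      iteratedDeriv_of_picardMap_eq hG hwc hfix hi him]
  refine ⟨w, hcd.contDiffOn, hw0, fun i hi him => ?_, fun r hr => ?_, fun r hr => ?_⟩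
  · rw [hwithin i hi him.le 0 self_mem_Ici]
    obtain ⟨j, hj⟩ := Nat.exists_eq_add_of_lt him
    rw [show m - i = j + 1 by omega, Function.iterate_succ_apply', primitiveZero_zero]
  · have hwr : w₀ ≤ w r := by
      rw [← hfix]
      exact le_picardMap hGpos w hr
    rw [hwithin m hm le_rfl r hr, Nat.sub_self, Function.iterate_zero_apply,
      max_eq_left (mem_Ici.1 hr)]
    simp only [hGdef, max_eq_left hwr]
  · rw [hw0]
    nth_rewrite 1 [← hfix]
    exact lt_add_of_pos_right _ (iterate_primitiveZero_pos (by fun_prop) (fun _ _ => hGpos _) m r hr)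
end
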